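/- arXiv:2405.12104 — 2 statements merged into one kernel-verified Lean document; each statement's English description precedes it below -/
import Mathlib

section
/- The general (unbounded) verification problem for HCMTL* in the point-based semantics is undecidable: there is no algorithm that, given a point-based timed automaton B and an HCMTL* sentence φ, decides whether {}, 0, ε ⊨_B φ under the point-based semantics. Undecidability already holds when φ is restricted to the HyperMITL fragment (all quantifiers at the top level and all intervals non-singular). -/
namespace HyTime

/-! ### Comparisons and clock constraints -/

/-- Comparison operators `<, ≤, =, ≥, >` used in clock constraints. -/
inductive Cmp where
  | lt | le | eq | ge | gt
  deriving DecidableEq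

def Cmp.denote : Cmp → ℝ → ℝ → Prop
  | .lt => fun a b => a < b
  | .le => fun a b => a ≤ b
  | .eq => fun a b => a = b
  | .ge => fun a b => b ≤ a
  | .gt => fun a b => b < a

def Cmp.code : Cmp → ℕ
  | .lt => 0
  | .le => 1
  | .eq => 2
  | .ge => 3
  | .gt => 4

/-- Clock constraints over one clock: positive boolean combinations of atoms `x ∼ c`,
where the constants `c` come from `α` (naturals, or rationals). -/
inductive ClkC (α : Type) where
  | atom : Cmp → α → ClkC α
  | disj : ClkC α → ClkC α → ClkC α
  | conj : ClkC α → ClkC α → ClkC α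
  deriving DecidableEq

namespace ClkC
variable {α β : Type}

/-- Satisfaction of a clock constraint by a clock value `v : ℝ`;
`toR` interprets the constants as reals. -/
def holds (toR : α → ℝ) (v : ℝ) : ClkC α → Prop
  | .atom c k => c.denote v (toR k)
  | .disj a b => a.holds toR v ∨ b.holds toR v
  | .conj a b => a.holds toR v ∧ b.holds toR v

/-- A missing constraint (`none`) is the trivial constraint. -/
def holdsOpt (toR : α → ℝ) (v : ℝ) : Option (ClkC α) → Prop
  | none => True
  | some c => c.holds toR v

def map (f : α → β) : ClkC α → ClkC β
  | .atom c k => .atom c (f k)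
  | .disj a b => .disj (a.map f) (b.map f)
  | .conj a b => .conj (a.map f) (b.map f)

/-- The list of constants appearing in a clock constraint. -/
def consts : ClkC α → List α
  | .atom _ k => [k]
  | .disj a b => a.consts ++ b.consts
  | .conj a b => a.consts ++ b.consts

end ClkC

/-- The canonical interpretation of natural-number constants as reals. -/
def natR : ℕ → ℝ := fun n => (n : ℝ)

/-- The canonical interpretation of rational constants as reals. -/
def ratR : ℚ → ℝ := fun q => (q : ℝ)

/-! ### Intervals of reals -/

/-- A bounded real interval, with open/closed information at both endpoints. -/
structure TIvl where
  lo : ℝ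
  hi : ℝ
  loC : Bool
  hiC : Bool
  deriving Inhabited

namespace TIvl

/-- Membership of a time point in an interval. -/
def Mem (t : ℝ) (I : TIvl) : Prop :=
  (if I.loC then I.lo ≤ t else I.lo < t) ∧ (if I.hiC then t ≤ I.hi else t < I.hi)

/-- A well-formed (nonempty) interval: either nondegenerate, or a closed singular interval. -/
def WF (I : TIvl) : Prop :=
  I.lo < I.hi ∨ (I.lo = I.hi ∧ I.loC = true ∧ I.hiC = true)

/-- Two intervals are consecutive: they share the endpoint `R(I) = L(J)`,
which belongs to exactly one of them (hence they are disjoint). -/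
def Consecutive (I J : TIvl) : Prop := I.hi = J.lo ∧ I.hiC = !J.loC

end TIvl

/-! ### Timed automata (interval-based) -/

/-- An edge of an interval-based timed automaton:
source, destination, guard (a set of constraints, each over a designated clock), reset set. -/
abbrev IEdge (α : Type) := ℕ × ℕ × List (ℕ × ClkC α) × List ℕ

/-- A timed automaton `A = (V, V₀, α, X, β, E, V_F)` over atomic propositions `props`.
States, propositions and clocks are natural numbers; all components are finite (lists).
`label` is the state labeling, `beta` assigns to (state, clock) pairs a clock constraint. -/
structure TA (α : Type) where
  states : List ℕ
  init : List ℕ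
  props : List ℕ
  clocks : List ℕ
  label : List (ℕ × List ℕ)
  beta : List ((ℕ × ℕ) × ClkC α)
  edges : List (IEdge α)
  final : List ℕ

namespace TA
variable {α β : Type}

def labelOf (A : TA α) (v : ℕ) : List ℕ := (A.label.lookup v).getD []

def betaOf (A : TA α) (v x : ℕ) : Option (ClkC α) :=
  (A.beta.find? (fun q => q.1.1 == v && q.1.2 == x)).map (·.2)

/-- All constants appearing in the constraints of a timed automaton. -/
def consts (A : TA α) : List α :=
  (A.beta.map (·.2)).flatMap ClkC.consts ++
    A.edges.flatMap (fun e => (e.2.2.1.map (·.2)).flatMap ClkC.consts)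

/-- Apply a function to every constant of the automaton. -/
def map (f : α → β) (A : TA α) : TA β where
  states := A.states
  init := A.init
  props := A.props
  clocks := A.clocks
  label := A.label
  beta := A.beta.map (fun q => (q.1, q.2.map f))
  edges := A.edges.map (fun e => (e.1, e.2.1, e.2.2.1.map (fun p => (p.1, p.2.map f)), e.2.2.2))
  final := A.final

end TA

/-! ### Executions of timed automata -/

/-- The raw data of an execution `(v₁,I₁) →^{γ₁}_{Ψ₁} ⋯ →^{γ_{n-1}}_{Ψ_{n-1}} (vₙ,Iₙ)`. -/
structure RawExec (α : Type) where
  states : List ℕ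
  ivls : List TIvl
  guards : List (List (ℕ × ClkC α))
  resets : List (List ℕ)
  deriving Inhabited

namespace RawExec
variable {α : Type}

def n (ρ : RawExec α) : ℕ := ρ.states.length
def ivl (ρ : RawExec α) (i : ℕ) : TIvl := ρ.ivls.getD i default
def state (ρ : RawExec α) (i : ℕ) : ℕ := ρ.states.getD i 0
def reset (ρ : RawExec α) (i : ℕ) : List ℕ := ρ.resets.getD i []
def guard (ρ : RawExec α) (i : ℕ) : List (ℕ × ClkC α) := ρ.guards.getD i []

/-- The `i`-th edge taken by the execution. -/
def edge (ρ : RawExec α) (i : ℕ) : IEdge α := (ρ.state i, ρ.state (i+1), ρ.guard i, ρ.reset i)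

/-- The clock valuation `μ_{i+1}` when entering the `(i+1)`-st state: clocks start at `0`,
advance with elapsed time, and the clocks reset at a transition are set to `0`. -/
def mu (ρ : RawExec α) : ℕ → ℕ → ℝ
  | 0, _ => 0
  | i+1, x => if x ∈ ρ.reset i then 0 else ρ.mu i x + ((ρ.ivl i).hi - (ρ.ivl i).lo)

/-- `t ∈ len(ρ)`. -/
def MemLen (t : ℝ) (ρ : RawExec α) : Prop := ∃ i, i < ρ.n ∧ TIvl.Mem t (ρ.ivl i)

/-- `ρ(t) = v`: at time `t` the execution is at state `v`. -/
def StateAt (ρ : RawExec α) (t : ℝ) (v : ℕ) : Prop :=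
  ∃ i, i < ρ.n ∧ TIvl.Mem t (ρ.ivl i) ∧ ρ.state i = v

/-- `ρ` is an execution of `A`: consistent lengths, an interval sequence starting at `0`,
an initial state, edges of `A`, state constraints throughout each interval, and
guard constraints at the transition times. -/
def IsExec (toR : α → ℝ) (A : TA α) (ρ : RawExec α) : Prop :=
  0 < ρ.n ∧ ρ.ivls.length = ρ.n ∧ ρ.guards.length = ρ.n - 1 ∧ ρ.resets.length = ρ.n - 1 ∧
  (ρ.ivl 0).lo = 0 ∧ (ρ.ivl 0).loC = true ∧
  (∀ i, i < ρ.n → (ρ.ivl i).WF) ∧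
  (∀ i, i + 1 < ρ.n → (ρ.ivl i).Consecutive (ρ.ivl (i+1))) ∧
  ρ.state 0 ∈ A.init ∧
  (∀ i, i + 1 < ρ.n → ρ.edge i ∈ A.edges) ∧
  (∀ i, i < ρ.n → ∀ x ∈ A.clocks, ∀ t : ℝ, TIvl.Mem t (ρ.ivl i) →
    ClkC.holdsOpt toR (ρ.mu i x + t - (ρ.ivl i).lo) (A.betaOf (ρ.state i) x)) ∧
  (∀ i, i + 1 < ρ.n → ∀ q ∈ ρ.guard i,
    ClkC.holds toR (ρ.mu i q.1 + (ρ.ivl i).hi - (ρ.ivl i).lo) q.2)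

/-- An accepting execution: ends in a final state. -/
def IsAccExec (toR : α → ℝ) (A : TA α) (ρ : RawExec α) : Prop :=
  ρ.IsExec toR A ∧ ρ.state (ρ.n - 1) ∈ A.final

/-- The execution is bounded by `N`: no time point `≥ N` belongs to it. -/
def BoundedBy (ρ : RawExec α) (N : ℝ) : Prop := ∀ t : ℝ, N ≤ t → ¬ MemLen t ρ

/-- Membership in `Exec(A)` (if `bd = none`) resp. `Exec_N(A)` (if `bd = some N`). -/
def InSem (toR : α → ℝ) (A : TA α) (bd : Option ℝ) (ρ : RawExec α) : Prop :=
  ρ.IsAccExec toR A ∧ ∀ N, bd = some N → ρ.BoundedBy N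

/-- Index of the interval containing `t`. -/
noncomputable def idxAt (ρ : RawExec α) (t : ℝ) : ℕ :=
  ρ.ivls.findIdx (fun I => @decide (TIvl.Mem t I) (Classical.propDecidable _))

/-- The prefix `ρ|_t` of an execution up to time `t`:
the last interval is intersected with `[0, t]`. -/
noncomputable def prefixUpTo (ρ : RawExec α) (t : ℝ) : RawExec α :=
  let i := ρ.idxAt t
  ⟨ρ.states.take (i + 1),
   ρ.ivls.take i ++ [⟨(ρ.ivl i).lo, t, (ρ.ivl i).loC, true⟩],
   ρ.guards.take i, ρ.resets.take i⟩

/-- Two executions are equal up to time `t` if their prefixes up to `t` are identical. -/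
def EqUpTo (ρ₁ ρ₂ : RawExec α) (t : ℝ) : Prop := ρ₁.prefixUpTo t = ρ₂.prefixUpTo t

end RawExec

/-! ### HCMTL* syntax -/

/-- An interval annotating a temporal operator: endpoints from `α`, with `hi = none`
denoting `∞`. -/
structure FIvl (α : Type) where
  lo : α
  hi : Option α
  loC : Bool
  hiC : Bool

namespace FIvl
variable {α β : Type}

/-- `t ∈ base + I`. -/
def Mem (toR : α → ℝ) (base t : ℝ) (I : FIvl α) : Prop :=
  (if I.loC then base + toR I.lo ≤ t else base + toR I.lo < t) ∧
  (∀ h, I.hi = some h → (if I.hiC then t ≤ base + toR h else t < base + toR h))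

/-- A singular interval `[c, c]`. -/
def Singular (I : FIvl α) : Prop := I.loC = true ∧ I.hiC = true ∧ I.hi = some I.lo

def map (f : α → β) (I : FIvl α) : FIvl β := ⟨f I.lo, I.hi.map f, I.loC, I.hiC⟩

def consts (I : FIvl α) : List α := I.lo :: I.hi.toList

end FIvl

/-- HCMTL* formulas in negation normal form:
`φ ::= p_π | ¬p_π | φ ∨ φ | φ ∧ φ | F_I φ | G_I φ | φ U_I φ | ∃π φ | ∀π φ`.
Propositions and path variables are natural numbers; interval endpoints come from `α`. -/
inductive HF (α : Type) where
  | pos : ℕ → ℕ → HF α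
  | neg : ℕ → ℕ → HF α
  | disj : HF α → HF α → HF α
  | conj : HF α → HF α → HF α
  | fut : FIvl α → HF α → HF α
  | glob : FIvl α → HF α → HF α
  | untl : FIvl α → HF α → HF α → HF α
  | ex : ℕ → HF α → HF α
  | all : ℕ → HF α → HF α

namespace HF
variable {α β : Type}

/-- Free path variables. -/
def free : HF α → Finset ℕ
  | .pos _ π => {π}
  | .neg _ π => {π}
  | .disj a b => a.free ∪ b.free
  | .conj a b => a.free ∪ b.free
  | .fut _ a => a.free
  | .glob _ a => a.free
  | .untl _ a b => a.free ∪ b.free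
  | .ex π a => a.free.erase π
  | .all π a => a.free.erase π

/-- A sentence has no free path variables. -/
def Sentence (φ : HF α) : Prop := φ.free = ∅

/-- Quantifier-free formulas. -/
def QFree : HF α → Prop
  | .pos _ _ => True
  | .neg _ _ => True
  | .disj a b => a.QFree ∧ b.QFree
  | .conj a b => a.QFree ∧ b.QFree
  | .fut _ a => a.QFree
  | .glob _ a => a.QFree
  | .untl _ a b => a.QFree ∧ b.QFree
  | .ex _ _ => False
  | .all _ _ => False

/-- All intervals occurring in the formula are non-singular. -/
def NonSing : HF α → Prop
  | .pos _ _ => True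
  | .neg _ _ => True
  | .disj a b => a.NonSing ∧ b.NonSing
  | .conj a b => a.NonSing ∧ b.NonSing
  | .fut I a => ¬ I.Singular ∧ a.NonSing
  | .glob I a => ¬ I.Singular ∧ a.NonSing
  | .untl I a b => ¬ I.Singular ∧ a.NonSing ∧ b.NonSing
  | .ex _ a => a.NonSing
  | .all _ a => a.NonSing

/-- The HyperMITL fragment: all quantifiers at the top level, all intervals non-singular. -/
def HyperMITL : HF α → Prop
  | .ex _ a => a.HyperMITL
  | .all _ a => a.HyperMITL
  | φ => φ.QFree ∧ φ.NonSing

/-- Apply a function to every interval endpoint of the formula. -/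
def map (f : α → β) : HF α → HF β
  | .pos p π => .pos p π
  | .neg p π => .neg p π
  | .disj a b => .disj (a.map f) (b.map f)
  | .conj a b => .conj (a.map f) (b.map f)
  | .fut I a => .fut (I.map f) (a.map f)
  | .glob I a => .glob (I.map f) (a.map f)
  | .untl I a b => .untl (I.map f) (a.map f) (b.map f)
  | .ex π a => .ex π (a.map f)
  | .all π a => .all π (a.map f)

/-- The list of interval endpoints appearing in the formula. -/
def consts : HF α → List α
  | .pos _ _ => []
  | .neg _ _ => []
  | .disj a b => a.consts ++ b.consts
  | .conj a b => a.consts ++ b.consts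
  | .fut I a => I.consts ++ a.consts
  | .glob I a => I.consts ++ a.consts
  | .untl I a b => I.consts ++ a.consts ++ b.consts
  | .ex _ a => a.consts
  | .all _ a => a.consts

end HF

/-! ### HCMTL* interval-based semantics -/

/-- Time bound restriction: with `bd = some N`, only times `< N` are considered. -/
def inBd : Option ℝ → ℝ → Prop
  | none, _ => True
  | some N, t => t < N

/-- The interval-based satisfaction relation `Π, t, † ⊨_A φ` (with `bd = none`),
resp. its time-bounded variant `Π, t, † ⊨^N_A φ` (with `bd = some N`).
`d = none` represents `† = ε`, and `d = some π` represents `† = π`. -/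
def HSat {α : Type} (toR : α → ℝ) (A : TA α) (bd : Option ℝ) :
    HF α → (ℕ → RawExec α) → ℝ → Option ℕ → Prop
  | .pos p π, Env, t, _ =>
      RawExec.MemLen t (Env π) ∧ ∃ v, RawExec.StateAt (Env π) t v ∧ p ∈ A.labelOf v
  | .neg p π, Env, t, _ =>
      RawExec.MemLen t (Env π) ∧ ∃ v, RawExec.StateAt (Env π) t v ∧ p ∉ A.labelOf v
  | .disj a b, Env, t, d => HSat toR A bd a Env t d ∨ HSat toR A bd b Env t d
  | .conj a b, Env, t, d => HSat toR A bd a Env t d ∧ HSat toR A bd b Env t d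
  | .fut I a, Env, t, d => ∃ t', t < t' ∧ inBd bd t' ∧ FIvl.Mem toR t t' I ∧
      HSat toR A bd a Env t' d
  | .glob I a, Env, t, d => ∀ t', t < t' → inBd bd t' → FIvl.Mem toR t t' I →
      HSat toR A bd a Env t' d
  | .untl I a b, Env, t, d => ∃ t', t < t' ∧ inBd bd t' ∧ FIvl.Mem toR t t' I ∧
      HSat toR A bd b Env t' d ∧ ∀ t'', t < t'' → t'' < t' → HSat toR A bd a Env t'' d
  | .ex π a, Env, t, d => ∃ ρ, RawExec.InSem toR A bd ρ ∧
      ((d = none ∧ t = 0) ∨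
        ∃ d₀, d = some d₀ ∧ RawExec.MemLen t (Env d₀) ∧ RawExec.EqUpTo ρ (Env d₀) t) ∧
      HSat toR A bd a (Function.update Env π ρ) t (some π)
  | .all π a, Env, t, d => ∀ ρ, RawExec.InSem toR A bd ρ →
      ((d = none ∧ t = 0) ∨
        ∃ d₀, d = some d₀ ∧ RawExec.MemLen t (Env d₀) ∧ RawExec.EqUpTo ρ (Env d₀) t) →
      HSat toR A bd a (Function.update Env π ρ) t (some π)

/-! ### MSO(<, +1) -/

/-- MSO(<,+1) formulas over monadic predicate names `σ` and first-order variables `ℕ`: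
`φ ::= x < y | +1(x,y) | P(x) | φ ∨ φ | ¬φ | ∃x φ | ∃P φ`. -/
inductive MSO (σ : Type) where
  | lt : ℕ → ℕ → MSO σ
  | succ : ℕ → ℕ → MSO σ
  | app : σ → ℕ → MSO σ
  | disj : MSO σ → MSO σ → MSO σ
  | neg : MSO σ → MSO σ
  | exFO : ℕ → MSO σ → MSO σ
  | exSO : σ → MSO σ → MSO σ

/-- Continuity of a flow at `t` (within the time domain `D`). -/
def ContAt {σ : Type} (D : Set ℝ) (f : ℝ → Set σ) (t : ℝ) : Prop :=
  ∃ ε : ℝ, 0 < ε ∧ ∀ s ∈ D, |s - t| < ε → f s = f t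

/-- A flow is finitely variable: on every bounded interval it has only finitely many
discontinuities. -/
def FinVar {σ : Type} (D : Set ℝ) (f : ℝ → Set σ) : Prop :=
  ∀ a b : ℝ, Set.Finite {t | t ∈ D ∩ Set.Icc a b ∧ ¬ ContAt D f t}

namespace MSO
variable {σ : Type}

/-- Satisfaction `f, I ⊨ φ` of an MSO(<,+1) formula over the time domain `D`,
by a flow `f` and a first-order interpretation `ivar`. Second-order quantification
ranges over finitely variable flows agreeing with `f` except at the quantified predicate. -/
def Sat (D : Set ℝ) : MSO σ → (ℝ → Set σ) → (ℕ → ℝ) → Prop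
  | .lt x y, _, ivar => ivar x < ivar y
  | .succ x y, _, ivar => ivar y = ivar x + 1
  | .app P x, f, ivar => P ∈ f (ivar x)
  | .disj a b, f, ivar => Sat D a f ivar ∨ Sat D b f ivar
  | .neg a, f, ivar => ¬ Sat D a f ivar
  | .exFO x a, f, ivar => ∃ r ∈ D, Sat D a f (Function.update ivar x r)
  | .exSO P a, f, ivar => ∃ g : ℝ → Set σ, FinVar D g ∧
      (∀ t ∈ D, ∀ Q, Q ≠ P → (Q ∈ g t ↔ Q ∈ f t)) ∧ Sat D a g ivar

/-- Free first-order variables. -/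
def freeFO : MSO σ → Finset ℕ
  | .lt x y => {x, y}
  | .succ x y => {x, y}
  | .app _ x => {x}
  | .disj a b => a.freeFO ∪ b.freeFO
  | .neg a => a.freeFO
  | .exFO x a => a.freeFO.erase x
  | .exSO _ a => a.freeFO

/-- Free monadic (second-order) predicates. -/
def freeSO [DecidableEq σ] : MSO σ → Finset σ
  | .lt _ _ => ∅
  | .succ _ _ => ∅
  | .app P _ => {P}
  | .disj a b => a.freeSO ∪ b.freeSO
  | .neg a => a.freeSO
  | .exFO _ a => a.freeSO
  | .exSO P a => a.freeSO.erase P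

/-- Purely first-order formulas: no monadic predicates occur at all. -/
def FOonly : MSO σ → Prop
  | .lt _ _ => True
  | .succ _ _ => True
  | .app _ _ => False
  | .disj a b => a.FOonly ∧ b.FOonly
  | .neg a => a.FOonly
  | .exFO _ a => a.FOonly
  | .exSO _ _ => False

end MSO

/-! ### The monadic predicates `MP = V ∪ T ∪ R` and the encoding ι of executions as flows -/

/-- The monadic predicates associated to a timed automaton: states `v`, transition markers
`T⁻_e`, `T⁺_e` for edges `e`, and reset markers `R⁰_x`, `R¹_x` for clocks `x`. -/
inductive MPred (α : Type) where
  | st : ℕ → MPred α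
  | tminus : IEdge α → MPred α
  | tplus : IEdge α → MPred α
  | r0 : ℕ → MPred α
  | r1 : ℕ → MPred α
  deriving DecidableEq

/-- The encoding `ι_A` of an execution as a flow over `MP = V ∪ T ∪ R`:
at each time, the current state; at a `T⁻` transition time `t = L(I_{i+1}) ∈ I_{i+1}`,
the marker `T⁻_e` and resets `R⁰_x` (for the clocks `x` reset by `e`);
at a `T⁺` transition time `t = R(I_i) ∈ I_i`, the marker `T⁺_e` and resets `R¹_x`;
and `∅` after the execution has ended. -/
def iota {α : Type} (ρ : RawExec α) (t : ℝ) : Set (MPred α) :=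
  {mp | match mp with
    | .st v => RawExec.StateAt ρ t v
    | .tminus e => ∃ i, i + 1 < ρ.n ∧ ρ.edge i = e ∧
        t = (ρ.ivl (i+1)).lo ∧ TIvl.Mem t (ρ.ivl (i+1))
    | .tplus e => ∃ i, i + 1 < ρ.n ∧ ρ.edge i = e ∧
        t = (ρ.ivl i).hi ∧ TIvl.Mem t (ρ.ivl i)
    | .r0 x => ∃ i, i + 1 < ρ.n ∧ x ∈ ρ.reset i ∧
        t = (ρ.ivl (i+1)).lo ∧ TIvl.Mem t (ρ.ivl (i+1))
    | .r1 x => ∃ i, i + 1 < ρ.n ∧ x ∈ ρ.reset i ∧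
        t = (ρ.ivl i).hi ∧ TIvl.Mem t (ρ.ivl i)}

/-- The combined flow `f_Π` of a path environment `Π` on path variables `1, …, m`,
over the pairwise disjoint indexed copies `MP_1 ∪ ⋯ ∪ MP_m` (tagged by the index). -/
def fPi (m : ℕ) (Env : ℕ → RawExec ℕ) : ℝ → Set (ℕ × MPred ℕ) :=
  fun t => {q | 1 ≤ q.1 ∧ q.1 ≤ m ∧ q.2 ∈ iota (Env q.1) t}

end HyTime

namespace HyTime

/-! ### Timed automata in the point-based semantics -/

/-- A transition of a point-based timed automaton: source state, event (a set of
propositions), guard, reset set, destination state. -/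
abbrev PEdge (α : Type) := ℕ × List ℕ × List (ℕ × ClkC α) × List ℕ × ℕ

def PEdge.src {α : Type} (e : PEdge α) : ℕ := e.1
def PEdge.event {α : Type} (e : PEdge α) : List ℕ := e.2.1
def PEdge.guard {α : Type} (e : PEdge α) : List (ℕ × ClkC α) := e.2.2.1
def PEdge.rst {α : Type} (e : PEdge α) : List ℕ := e.2.2.2.1
def PEdge.dst {α : Type} (e : PEdge α) : ℕ := e.2.2.2.2

/-- A timed automaton in the point-based semantics `B = (𝒫(P), S, s₀, X, Δ, F)`. -/
structure PTA (α : Type) where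
  states : List ℕ
  start : ℕ
  props : List ℕ
  clocks : List ℕ
  trans : List (PEdge α)
  final : List ℕ

/-- The raw data of a run `(s₀,μ₀) →^{e₁,t₁} ⋯ →^{eₙ,tₙ} (sₙ,μₙ)`:
the transitions taken and their times. -/
structure PRun (α : Type) where
  edges : List (PEdge α)
  times : List ℝ
  deriving Inhabited

namespace PRun
variable {α : Type}

def n (η : PRun α) : ℕ := η.edges.length
def edge (η : PRun α) (i : ℕ) : PEdge α := η.edges.getD i default
def time (η : PRun α) (i : ℕ) : ℝ := η.times.getD i 0
def tprev (η : PRun α) (i : ℕ) : ℝ := if i = 0 then 0 else η.time (i - 1)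

/-- The clock valuation `μ_i` after `i` transitions. -/
def mu (η : PRun α) : ℕ → ℕ → ℝ
  | 0, _ => 0
  | i+1, x => if x ∈ PEdge.rst (η.edge i) then 0 else η.mu i x + (η.time i - η.tprev i)

/-- `η` is a run of `B`: nonempty, increasing nonnegative transition times,
starting at the start state, consecutive transitions of `Δ`, guards holding at
transition times. -/
def IsRun (toR : α → ℝ) (B : PTA α) (η : PRun α) : Prop :=
  0 < η.n ∧ η.times.length = η.n ∧
  0 ≤ η.time 0 ∧ (∀ i, i + 1 < η.n → η.time i < η.time (i+1)) ∧
  PEdge.src (η.edge 0) = B.start ∧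
  (∀ i, i < η.n → η.edge i ∈ B.trans) ∧
  (∀ i, i + 1 < η.n → PEdge.src (η.edge (i+1)) = PEdge.dst (η.edge i)) ∧
  (∀ i, i < η.n → ∀ q ∈ PEdge.guard (η.edge i),
    ClkC.holds toR (η.mu i q.1 + (η.time i - η.tprev i)) q.2)

/-- An accepting run: ends in a final state. -/
def IsAccRun (toR : α → ℝ) (B : PTA α) (η : PRun α) : Prop :=
  η.IsRun toR B ∧ PEdge.dst (η.edge (η.n - 1)) ∈ B.final

/-- The duration `len(η) = tₙ` of a run. -/
def len (η : PRun α) : ℝ := η.time (η.n - 1)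

/-- All transition times are `< N`. -/
def BoundedBy (η : PRun α) (N : ℝ) : Prop := ∀ i, i < η.n → η.time i < N

/-- Membership in `Runs(B)` (if `bd = none`) resp. its bounded variant. -/
def InSem (toR : α → ℝ) (B : PTA α) (bd : Option ℝ) (η : PRun α) : Prop :=
  η.IsAccRun toR B ∧ ∀ N, bd = some N → η.BoundedBy N

/-- `t ∈ η`: `t` is one of the transition (event) times of `η`. -/
def EvtTime (η : PRun α) (t : ℝ) : Prop := ∃ i, i < η.n ∧ η.time i = t

/-- `η'` is an extension of `η` from time `t`: they agree on all transitions at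
times `≤ t`, and all later transitions (of either run) occur after `t`. -/
def ExtendsFrom (η' η : PRun α) (t : ℝ) : Prop :=
  ∃ i, i ≤ η.n ∧ i ≤ η'.n ∧
    η'.edges.take i = η.edges.take i ∧ η'.times.take i = η.times.take i ∧
    (∀ j, j < i → η.time j ≤ t) ∧
    (∀ j, i ≤ j → j < η.n → t < η.time j) ∧
    (∀ j, i ≤ j → j < η'.n → t < η'.time j)

end PRun

/-! ### HCMTL* point-based semantics -/

/-- The point-based satisfaction relation `Γ, t, † ⊨_B φ` (with `bd = none`),
resp. its time-bounded variant (with `bd = some N`). `V` is the current set of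
path variables (the domain of the environment `Γ`); temporal operators range only
over event points of the runs in `Γ`. -/
def PSat {α : Type} (toR : α → ℝ) (B : PTA α) (bd : Option ℝ) :
    HF α → Finset ℕ → (ℕ → PRun α) → ℝ → Option ℕ → Prop
  | .pos p π, _, Γ, t, _ =>
      ∃ i, i < (Γ π).n ∧ (Γ π).time i = t ∧ p ∈ PEdge.event ((Γ π).edge i)
  | .neg p π, _, Γ, t, _ =>
      ∃ i, i < (Γ π).n ∧ (Γ π).time i = t ∧ p ∉ PEdge.event ((Γ π).edge i)
  | .disj a b, V, Γ, t, d => PSat toR B bd a V Γ t d ∨ PSat toR B bd b V Γ t d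
  | .conj a b, V, Γ, t, d => PSat toR B bd a V Γ t d ∧ PSat toR B bd b V Γ t d
  | .fut I a, V, Γ, t, d => ∃ t', t < t' ∧ inBd bd t' ∧ FIvl.Mem toR t t' I ∧
      (∃ π ∈ V, PRun.EvtTime (Γ π) t') ∧ PSat toR B bd a V Γ t' d
  | .glob I a, V, Γ, t, d => ∀ t', t < t' → inBd bd t' → FIvl.Mem toR t t' I →
      (∃ π ∈ V, PRun.EvtTime (Γ π) t') → PSat toR B bd a V Γ t' d
  | .untl I a b, V, Γ, t, d => ∃ t', t < t' ∧ inBd bd t' ∧ FIvl.Mem toR t t' I ∧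
      (∃ π ∈ V, PRun.EvtTime (Γ π) t') ∧ PSat toR B bd b V Γ t' d ∧
      (∀ t'', t < t'' → t'' < t' → (∃ π ∈ V, PRun.EvtTime (Γ π) t'') →
        PSat toR B bd a V Γ t'' d)
  | .ex π a, V, Γ, t, d => ∃ η, PRun.InSem toR B bd η ∧
      ((d = none ∧ t = 0) ∨
        ∃ d₀, d = some d₀ ∧ t ≤ PRun.len (Γ d₀) ∧ PRun.ExtendsFrom η (Γ d₀) t) ∧
      PSat toR B bd a (insert π V) (Function.update Γ π η) t (some π)
  | .all π a, V, Γ, t, d => ∀ η, PRun.InSem toR B bd η →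
      ((d = none ∧ t = 0) ∨
        ∃ d₀, d = some d₀ ∧ t ≤ PRun.len (Γ d₀) ∧ PRun.ExtendsFrom η (Γ d₀) t) →
      PSat toR B bd a (insert π V) (Function.update Γ π η) t (some π)

/-! ### Concrete injective encodings of syntax into ℕ -/

def encList {α : Type} (f : α → ℕ) : List α → ℕ
  | [] => 0
  | a :: l => Nat.pair (f a) (encList f l) + 1

def encClkC : ClkC ℕ → ℕ
  | .atom c k => Nat.pair 0 (Nat.pair c.code k)
  | .disj a b => Nat.pair 1 (Nat.pair (encClkC a) (encClkC b))
  | .conj a b => Nat.pair 2 (Nat.pair (encClkC a) (encClkC b))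

def encGuard (g : List (ℕ × ClkC ℕ)) : ℕ := encList (fun q => Nat.pair q.1 (encClkC q.2)) g

def encIEdge (e : IEdge ℕ) : ℕ :=
  Nat.pair e.1 (Nat.pair e.2.1 (Nat.pair (encGuard e.2.2.1) (encList id e.2.2.2)))

/-- Injective encoding of timed automata as natural numbers. -/
def encTA (A : TA ℕ) : ℕ :=
  Nat.pair (encList id A.states) <| Nat.pair (encList id A.init) <|
  Nat.pair (encList id A.props) <| Nat.pair (encList id A.clocks) <|
  Nat.pair (encList (fun q => Nat.pair q.1 (encList id q.2)) A.label) <|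
  Nat.pair (encList (fun q => Nat.pair (Nat.pair q.1.1 q.1.2) (encClkC q.2)) A.beta) <|
  Nat.pair (encList encIEdge A.edges) (encList id A.final)

def encFIvl (I : FIvl ℕ) : ℕ :=
  Nat.pair I.lo <| Nat.pair (match I.hi with | none => 0 | some h => h + 1) <|
  Nat.pair I.loC.toNat I.hiC.toNat

/-- Injective encoding of HCMTL* formulas as natural numbers. -/
def encHF : HF ℕ → ℕ
  | .pos p π => Nat.pair 0 (Nat.pair p π)
  | .neg p π => Nat.pair 1 (Nat.pair p π)
  | .disj a b => Nat.pair 2 (Nat.pair (encHF a) (encHF b))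
  | .conj a b => Nat.pair 3 (Nat.pair (encHF a) (encHF b))
  | .fut I a => Nat.pair 4 (Nat.pair (encFIvl I) (encHF a))
  | .glob I a => Nat.pair 5 (Nat.pair (encFIvl I) (encHF a))
  | .untl I a b => Nat.pair 6 (Nat.pair (encFIvl I) (Nat.pair (encHF a) (encHF b)))
  | .ex π a => Nat.pair 7 (Nat.pair π (encHF a))
  | .all π a => Nat.pair 8 (Nat.pair π (encHF a))

def encPEdge (e : PEdge ℕ) : ℕ :=
  Nat.pair (PEdge.src e) <| Nat.pair (encList id (PEdge.event e)) <|
  Nat.pair (encGuard (PEdge.guard e)) <| Nat.pair (encList id (PEdge.rst e)) (PEdge.dst e)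

/-- Injective encoding of point-based timed automata as natural numbers. -/
def encPTA (B : PTA ℕ) : ℕ :=
  Nat.pair (encList id B.states) <| Nat.pair B.start <| Nat.pair (encList id B.props) <|
  Nat.pair (encList id B.clocks) <| Nat.pair (encList encPEdge B.trans) (encList id B.final)

/-- Injective encoding of MSO(<,+1) formulas as natural numbers. -/
def encMSO : MSO ℕ → ℕ
  | .lt x y => Nat.pair 0 (Nat.pair x y)
  | .succ x y => Nat.pair 1 (Nat.pair x y)
  | .app P x => Nat.pair 2 (Nat.pair P x)
  | .disj a b => Nat.pair 3 (Nat.pair (encMSO a) (encMSO b))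
  | .neg a => Nat.pair 4 (encMSO a)
  | .exFO x a => Nat.pair 5 (Nat.pair x (encMSO a))
  | .exSO P a => Nat.pair 6 (Nat.pair P (encMSO a))

/-! ### The interval-based automaton ⟦B⟧ associated to a point-based automaton B -/

/-- Code of an original state of `B` as a state of `⟦B⟧`. -/
def stCode (s : ℕ) : ℕ := 2 * s
/-- Code of a transition of `B` as a (transition-)state of `⟦B⟧`. -/
def edCode (e : PEdge ℕ) : ℕ := 2 * encPEdge e + 1
/-- The fresh proposition `#` marking transition-states. -/
def hashProp : ℕ := 0
/-- Code of an original proposition of `B` as a proposition of `⟦B⟧`. -/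
def propCode (p : ℕ) : ℕ := 2 * p + 1
/-- Code of a state of `B` as a proposition of `⟦B⟧` (over `P ∪ S ∪ {#}`). -/
def stPropCode (s : ℕ) : ℕ := 2 * s + 2
/-- Code of an original clock of `B` as a clock of `⟦B⟧`. -/
def clkCode (x : ℕ) : ℕ := x + 1
/-- The fresh clock `x_sing` forcing transition-states to be singular. -/
def xsing : ℕ := 0

/-- The interval-based timed automaton `⟦B⟧` over `P ∪ S ∪ {#}`: its states are the
states of `B` together with the transitions of `B`; transition-states are labeled by
their event together with `#`, carry the guard constraints and the constraint
`x_sing = 0`; edges alternate between states and transition-states, resetting `x_sing`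
on entry to a transition-state and the transition's resets on exit. -/
def ibOf (B : PTA ℕ) : TA ℕ where
  states := B.states.map stCode ++ B.trans.map edCode
  init := stCode B.start :: (B.trans.filter (fun e => PEdge.src e == B.start)).map edCode
  props := hashProp :: (B.props.map propCode ++ B.states.map stPropCode)
  clocks := xsing :: B.clocks.map clkCode
  label := B.states.map (fun s => (stCode s, [stPropCode s])) ++
    B.trans.map (fun e => (edCode e, hashProp :: (PEdge.event e).map propCode))
  beta := B.trans.map (fun e => ((edCode e, xsing), ClkC.atom Cmp.eq 0)) ++
    B.trans.flatMap (fun e => B.clocks.filterMap (fun x =>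
      match (PEdge.guard e).filter (fun q => q.1 == x) with
      | [] => none
      | q :: rest =>
          some ((edCode e, clkCode x), rest.foldl (fun acc r => ClkC.conj acc r.2) q.2)))
  edges := B.trans.flatMap (fun e =>
    [(stCode (PEdge.src e), edCode e, [], [xsing]),
     (edCode e, stCode (PEdge.dst e), [], (PEdge.rst e).map clkCode)])
  final := (B.trans.filter (fun e => B.final.contains (PEdge.dst e))).map edCode

/-- The map `χ` sending a run `(s₀,μ₀) →^{e₁,t₁} ⋯ →^{eₙ,tₙ} (sₙ,μₙ)` of `B` to the
execution `(s₀,[0,t₁)), (e₁,[t₁,t₁]), (s₁,(t₁,t₂)), …, (eₙ,[tₙ,tₙ])` of `⟦B⟧`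
(starting at `(e₁,[0,0])` if `t₁ = 0`). -/
noncomputable def chi (η : PRun ℕ) : RawExec ℕ :=
  let n := η.n
  let sts := η.edges.flatMap (fun e => [stCode (PEdge.src e), edCode e])
  let ivls := (List.range n).flatMap (fun i =>
    [⟨η.tprev i, η.time i, decide (i = 0), false⟩, ⟨η.time i, η.time i, true, true⟩])
  let gds : List (List (ℕ × ClkC ℕ)) := List.replicate (2 * n - 1) []
  let rsts := ((List.range n).flatMap
    (fun i => [[xsing], (PEdge.rst (η.edge i)).map clkCode])).take (2 * n - 1)
  if η.time 0 = 0 then ⟨sts.tail, ivls.tail, gds.tail, rsts.tail⟩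
  else ⟨sts, ivls, gds, rsts⟩

end HyTime

namespace HyTime

section Reduction

open Turing

/-- Restricting a machine to a supporting set of states does not change the domain. -/
theorem restrict_dom {Γ Λ : Type} [Inhabited Γ] [Inhabited Λ] (M : TM0.Machine Γ Λ)
    (S : Set Λ) (hS : TM0.Supports M S) :
    ∃ (_ : Inhabited S) (M' : TM0.Machine Γ S), ∀ l, (TM0.eval M' l).Dom ↔ (TM0.eval M l).Dom := by
  classical
  let iS : Inhabited S := ⟨⟨default, hS.1⟩⟩
  let M' : TM0.Machine Γ S := fun q a =>
    match h : M q.1 a with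
    | none => none
    | some (q', s) => some (⟨q', hS.2 (by rw [Option.mem_def]; exact h) q.2⟩, s)
  have hM' : ∀ q a, (M' q a).map (fun p => (p.1.1, p.2)) = M q.1 a := by
    intro q a
    simp only [M']
    split <;> simp_all
  refine ⟨iS, M', fun l => ?_⟩
  let tr : TM0.Cfg Γ S → TM0.Cfg Γ Λ := fun c => ⟨c.q.1, c.Tape⟩
  have hr : StateTransition.Respects (TM0.step M') (TM0.step M) (fun a b => tr a = b) := by
    rw [StateTransition.fun_respects]
    rintro ⟨q, T⟩
    have h := hM' q T.1
    cases h' : M' q T.1 with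
    | none =>
      have : TM0.step M' ⟨q, T⟩ = none := by simp [TM0.step, h']
      rw [this]
      rw [h'] at h
      simp [StateTransition.FRespects, tr, TM0.step, ← h]
    | some p =>
      rw [h'] at h
      obtain ⟨q', s⟩ := p
      have h1 : TM0.step M' ⟨q, T⟩ = some ⟨q', match s with
        | TM0.Stmt.move d => T.move d
        | TM0.Stmt.write a => T.write a⟩ := by cases s <;> simp [TM0.step, h']
      rw [h1]
      refine Relation.TransGen.single ?_
      cases s <;> simp [TM0.step, tr, ← h]
  have := StateTransition.tr_eval_dom hr (a₁ := TM0.init l) (a₂ := TM0.init l) rfl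
  simpa [TM0.eval] using this.symm

theorem trPosNum_shift (n : ℕ) :
    ∃ p : PosNum, ((2 ^ n : ℕ) : Num) = Num.pos p ∧
      PartrecToTM2.trPosNum p
        = List.replicate n PartrecToTM2.Γ'.bit0 ++ [PartrecToTM2.Γ'.bit1] := by
  induction n with
  | zero => exact ⟨1, by simp; rfl, rfl⟩
  | succ n ih =>
    obtain ⟨p, h, h'⟩ := ih
    refine ⟨p.bit0, ?_, by rw [PartrecToTM2.trPosNum, h', List.replicate_succ]; rfl⟩
    rw [pow_succ, mul_two, Nat.cast_add, h, Num.bit0_of_bit0]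
    rfl

/-- There is a fixed Turing machine whose halting problem on the
inputs `c₀ c₁ bⁿ` is undecidable. -/
theorem exists_undecidable_machine :
    ∃ (Γ Q : Type) (_ : Fintype Γ) (_ : Fintype Q) (_ : Inhabited Γ) (_ : Inhabited Q)
      (M : TM0.Machine Γ Q) (c₀ c₁ b : Γ),
      ¬ ComputablePred fun n : ℕ => (TM0.eval M (c₀ :: c₁ :: List.replicate n b)).Dom := by
  classical
  -- a partial recursive function whose domain, on powers of two, is undecidable
  let f : ℕ →. ℕ := fun m => Nat.Partrec.Code.eval (Denumerable.ofNat _ (Nat.findGreatest (2 ^ · = m) m)) 0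
  have hf : Partrec f := by
    refine Nat.Partrec.Code.eval_part.comp ?_ (Computable.const 0)
    refine (Computable.ofNat _).comp ?_
    have hpow : Primrec fun k : ℕ => 2 ^ k :=
      (Primrec.nat_rec₁ 1 <| Primrec.to₂ (Primrec.nat_mul.comp Primrec.snd (Primrec.const 2 : Primrec fun _ : ℕ × ℕ => 2))).of_eq fun k => by
        induction k with
        | zero => rfl
        | succ k ih => rw [pow_succ, ← ih]
    exact (Primrec.nat_findGreatest Primrec.id
      (Primrec.eq.comp₂ (hpow.comp Primrec.snd).to₂ Primrec.fst.to₂)).to_comp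
  have hlog : ∀ n, Nat.findGreatest (2 ^ · = 2 ^ n) (2 ^ n) = n := fun n =>
    Nat.pow_right_injective le_rfl
      (Nat.findGreatest_spec (P := (2 ^ · = 2 ^ n)) Nat.lt_two_pow_self.le rfl)
  have hund : ¬ ComputablePred fun n : ℕ => (f (2 ^ n)).Dom := by
    intro h
    refine ComputablePred.halting_problem 0 ?_
    obtain ⟨_, h⟩ := h
    refine ComputablePred.of_eq ⟨_, h.comp Computable.encode⟩ fun c => ?_
    simp only [f, hlog, Denumerable.ofNat_encode]
  obtain ⟨c, hc⟩ := ToPartrec.Code.exists_code (Nat.Partrec'.part_iff₁.2 hf)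
  let : Inhabited PartrecToTM2.Λ' := ⟨PartrecToTM2.trNormal c PartrecToTM2.Cont'.halt⟩
  have hTM2 : ∀ v : ℕ, (TM2.eval PartrecToTM2.tr PartrecToTM2.K'.main
      (PartrecToTM2.trList [v])).Dom ↔ (f v).Dom := by
    intro v
    have h1 := PartrecToTM2.tr_eval c [v]
    have h2 := hc ⟨[v], rfl⟩
    have h3 : (TM2.init PartrecToTM2.K'.main (PartrecToTM2.trList [v]) : PartrecToTM2.Cfg')
        = PartrecToTM2.init c [v] := by
      unfold TM2.init PartrecToTM2.init
      congr 1
      funext k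
      cases k <;> simp [PartrecToTM2.K'.elim, Function.update]
    have h4 : (StateTransition.eval (TM2.step PartrecToTM2.tr)
      (PartrecToTM2.init c [v])).Dom ↔ (f v).Dom := by
      rw [h1]
      change (c.eval [v]).Dom ↔ _
      change c.eval [v] = _ at h2
      rw [h2]
      rfl
    rw [← h4, ← h3]
    rfl
  have hs2 := PartrecToTM2.tr_supports c PartrecToTM2.Cont'.halt
  have hs1 := TM2to1.tr_supports (M := PartrecToTM2.tr) hs2
  have hs0 := TM1to0.tr_supports _ hs1
  obtain ⟨iS, M', hM'⟩ := restrict_dom _ _ hs0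
  let : Fintype PartrecToTM2.K' :=
    ⟨{.main, .rev, .aux, .stack}, fun k => by cases k <;> simp⟩
  have iΓ : Fintype (TM2to1.Γ' PartrecToTM2.K' fun _ => PartrecToTM2.Γ') := by
    unfold TM2to1.Γ'; infer_instance
  refine ⟨_, _, iΓ, inferInstance, inferInstance, iS, M', 
    (true, Function.update (fun _ => none) PartrecToTM2.K'.main (some PartrecToTM2.Γ'.cons)),
    (false, Function.update (fun _ => none) PartrecToTM2.K'.main (some PartrecToTM2.Γ'.bit1)),
    (false, Function.update (fun _ => none) PartrecToTM2.K'.main (some PartrecToTM2.Γ'.bit0)), 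
    fun h => hund (h.of_eq fun n => ?_)⟩
  rw [hM', TM1to0.tr_eval, ← hTM2]
  refine Iff.trans ?_ (TM2to1.tr_eval_dom (M := PartrecToTM2.tr) .main _)
  refine iff_of_eq (congrArg (fun l => (TM1.eval (TM2to1.tr PartrecToTM2.tr) l).Dom) (Eq.symm ?_))
  obtain ⟨p, hp, hp'⟩ := trPosNum_shift n
  simp only [TM2to1.trInit, PartrecToTM2.trList, PartrecToTM2.trNat, hp, PartrecToTM2.trNum, hp']
  simp only [List.reverse_append, List.reverse_cons, List.reverse_replicate, List.reverse_nil,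
    List.nil_append, List.cons_append]
  exact congrArg (fun l => _ :: _ :: l) List.map_replicate

/-! ### Space-time diagrams of Turing machines -/

/-- A cell of a space-time diagram: `none` is the row separator, and `some (s, q)` is a tape
cell with content `s`, scanned in state `q'` if `q = some q'`. -/
abbrev Cell (Γ Q : Type) := Option (Γ × Option Q)

/-- The state brought into the next cell in direction `d` by the head in the given cell. -/
def outgoing {Γ Q : Type} [Inhabited Q] (M : TM0.Machine Γ Q) (d : Dir) : Cell Γ Q → Option Q
  | some (s, some q) =>
    match M q s with
    | some (q', .move d') => if d = d' then some q' else none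
    | _ => none
  | _ => none

/-- The local update rule of space-time diagrams. -/
def nextCell {Γ Q : Type} [Inhabited Q] (M : TM0.Machine Γ Q) (l c r : Cell Γ Q) : Cell Γ Q :=
  match c with
  | none => none
  | some (s, some q) =>
    match M q s with
    | none => some (s, some q)
    | some (q', .write s') => some (s', some q')
    | some (_, .move _) => some (s, none)
  | some (s, none) => some (s, outgoing M .right l <|> outgoing M .left r)

/-- A cell with no head on it. -/
def Headless {Γ Q : Type} (c : Cell Γ Q) : Prop := ∀ s q, c ≠ some (s, some q)

/-- A cell whose head cannot move on. -/
def HaltCell {Γ Q : Type} [Inhabited Q] (M : TM0.Machine Γ Q) (c : Cell Γ Q) : Prop :=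
  ∃ s q, c = some (s, some q) ∧ M q s = none

theorem Headless.outgoing {Γ Q : Type} [Inhabited Q] {M : TM0.Machine Γ Q} {c : Cell Γ Q} (h : Headless c) (d : Dir) :
    outgoing M d c = none := by
  rcases c with _ | ⟨s, _ | q⟩
  · rfl
  · rfl
  · exact absurd rfl (h s q)

/-- One step of the machine on a configuration with absolute head position;
halted configurations stay put. -/
def stepAbs {Γ Q : Type} [Inhabited Γ] [Inhabited Q] (M : TM0.Machine Γ Q) (c : TM0.Cfg Γ Q × ℤ) : TM0.Cfg Γ Q × ℤ :=
  match M c.1.q c.1.Tape.head with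
  | none => c
  | some (q', .move d) => (⟨q', c.1.Tape.move d⟩, c.2 + (match d with | .left => -1 | .right => 1))
  | some (q', .write s) => (⟨q', c.1.Tape.write s⟩, c.2)

/-- The cell at absolute position `z` of a configuration. -/
def cellAt {Γ Q : Type} [Inhabited Γ] (c : TM0.Cfg Γ Q × ℤ) (z : ℤ) : Cell Γ Q :=
  some (c.1.Tape.nth (z - c.2), if z = c.2 then some c.1.q else none)

theorem headless_cellAt {Γ Q : Type} [Inhabited Γ] {c : TM0.Cfg Γ Q × ℤ} {z : ℤ} (h : z ≠ c.2) : Headless (cellAt c z) := by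
  intro s q
  simp [cellAt, h]

theorem nextCell_cellAt {Γ Q : Type} [Inhabited Γ] [Inhabited Q] (M : TM0.Machine Γ Q)
    (c : TM0.Cfg Γ Q × ℤ) (z : ℤ) (l r : Cell Γ Q)
    (hl : outgoing M .right l = outgoing M .right (cellAt c (z - 1)))
    (hr : outgoing M .left r = outgoing M .left (cellAt c (z + 1))) :
    nextCell M l (cellAt c z) r = cellAt (stepAbs M c) z := by
  obtain ⟨⟨q, T⟩, h⟩ := c
  have key : z = h ∨ z = h + 1 ∨ z = h - 1 ∨ (z ≠ h ∧ z - 1 ≠ h ∧ z + 1 ≠ h) := by omega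
  rcases key with rfl | rfl | rfl | ⟨h1, h2, h3⟩
  · cases hM : M q T.head with
    | none => simp [nextCell, cellAt, stepAbs, hM]
    | some p =>
      obtain ⟨q', (_ | _) | s⟩ := p <;> simp [nextCell, cellAt, stepAbs, hM]
      rfl
  · have e1 : cellAt (⟨q, T⟩, h) (h + 1) = some (T.nth 1, none) := by simp [cellAt]
    rw [(headless_cellAt (c := (⟨q, T⟩, h)) (show h + 1 + 1 ≠ h by omega)).outgoing] at hr
    rw [e1]
    simp only [nextCell, hl, hr]
    cases hM : M q T.head with
    | none => simp [outgoing, cellAt, stepAbs, hM]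
    | some p =>
      obtain ⟨q', (_ | _) | s⟩ := p <;> simp [outgoing, cellAt, stepAbs, hM]
      rw [← Tape.nth_zero, Tape.move_right_nth, zero_add]
  · have e1 : cellAt (⟨q, T⟩, h) (h - 1) = some (T.nth (-1), none) := by simp [cellAt]
    rw [(headless_cellAt (c := (⟨q, T⟩, h)) (show h - 1 - 1 ≠ h by omega)).outgoing] at hl
    rw [e1]
    simp only [nextCell, hl, hr]
    cases hM : M q T.head with
    | none => simp [outgoing, cellAt, stepAbs, hM]
    | some p =>
      obtain ⟨q', (_ | _) | s⟩ := p <;> simp [outgoing, cellAt, stepAbs, hM, ← sub_eq_add_neg]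
      · rw [← Tape.nth_zero, Tape.move_left_nth, zero_sub]
      · exact ⟨by congr 1; ring, by omega⟩
  · have e1 : cellAt (⟨q, T⟩, h) z = some (T.nth (z - h), none) := by simp [cellAt, h1]
    rw [(headless_cellAt (c := (⟨q, T⟩, h)) h2).outgoing] at hl
    rw [(headless_cellAt (c := (⟨q, T⟩, h)) h3).outgoing] at hr
    rw [e1]
    simp only [nextCell, hl, hr]
    have h4 : z - h ≠ 0 := by omega
    cases hM : M q T.head with
    | none => simp [cellAt, stepAbs, hM, h1]
    | some p =>
      obtain ⟨q', (_ | _) | s⟩ := p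
      · have e : z - (h + -1) - 1 = z - h := by ring
        have e' : z ≠ h + -1 := by omega
        simp [cellAt, stepAbs, hM, e, e']
      · have e : z - (h + 1) + 1 = z - h := by ring
        have e' : z ≠ h + 1 := by omega
        simp [cellAt, stepAbs, hM, e, e']
      · simp [cellAt, stepAbs, hM, h1, h4]

theorem Headless.nextCell {Γ Q : Type} [Inhabited Q] {M : TM0.Machine Γ Q} {l c r : Cell Γ Q}
    (hl : Headless l) (hc : Headless c) (hr : Headless r) : Headless (nextCell M l c r) := by
  rcases c with _ | ⟨s, _ | q⟩
  · exact hc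
  · simp [HyTime.nextCell, hl.outgoing, hr.outgoing, Headless]
  · exact absurd rfl (hc s q)

/-- The orbit of a configuration, with absolute head positions. -/
def orbit {Γ Q : Type} [Inhabited Γ] [Inhabited Q] (M : TM0.Machine Γ Q) (l : List Γ) (i : ℕ) :
    TM0.Cfg Γ Q × ℤ :=
  (stepAbs M)^[i] (TM0.init l, 0)

theorem orbit_succ {Γ Q : Type} [Inhabited Γ] [Inhabited Q] (M : TM0.Machine Γ Q) (l : List Γ)
    (i : ℕ) : orbit M l (i + 1) = stepAbs M (orbit M l i) :=
  Function.iterate_succ_apply' _ _ _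

/-- The machine has halted in the given configuration. -/
def Halted {Γ Q : Type} [Inhabited Γ] [Inhabited Q] (M : TM0.Machine Γ Q)
    (c : TM0.Cfg Γ Q × ℤ) : Prop :=
  M c.1.q c.1.Tape.head = none

theorem haltCell_cellAt {Γ Q : Type} [Inhabited Γ] [Inhabited Q] {M : TM0.Machine Γ Q}
    {c : TM0.Cfg Γ Q × ℤ} {z : ℤ} : HaltCell M (cellAt c z) ↔ z = c.2 ∧ Halted M c := by
  by_cases h : z = c.2
  · subst h
    simp [HaltCell, cellAt, Halted]
  · simp [HaltCell, cellAt, h]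

theorem step_eq_stepAbs {Γ Q : Type} [Inhabited Γ] [Inhabited Q] (M : TM0.Machine Γ Q)
    (c : TM0.Cfg Γ Q × ℤ) :
    (Halted M c ∧ TM0.step M c.1 = none ∧ stepAbs M c = c) ∨
      (¬ Halted M c ∧ TM0.step M c.1 = some (stepAbs M c).1) := by
  obtain ⟨⟨q, T⟩, h⟩ := c
  cases hM : M q T.head with
  | none => simp [Halted, TM0.step, stepAbs, hM]
  | some p => obtain ⟨q', d | s⟩ := p <;> simp [Halted, TM0.step, stepAbs, hM]

theorem eval_dom_iff_halted {Γ Q : Type} [Inhabited Γ] [Inhabited Q] (M : TM0.Machine Γ Q)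
    (l : List Γ) : (TM0.eval M l).Dom ↔ ∃ i, Halted M (orbit M l i) := by
  have hreach : ∀ i, StateTransition.Reaches (TM0.step M) (TM0.init l) (orbit M l i).1 := by
    intro i
    induction i with
    | zero => exact Relation.ReflTransGen.refl
    | succ i ih =>
      rw [orbit_succ]
      rcases step_eq_stepAbs M (orbit M l i) with ⟨_, _, h⟩ | ⟨_, h⟩
      · rwa [h]
      · exact ih.tail h
  have horb : ∀ b, StateTransition.Reaches (TM0.step M) (TM0.init l) b →
      ∃ i, (orbit M l i).1 = b := by
    intro b hb
    induction hb with
    | refl => exact ⟨0, rfl⟩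
    | tail _ h ih =>
      obtain ⟨i, rfl⟩ := ih
      refine ⟨i + 1, ?_⟩
      rw [orbit_succ]
      rcases step_eq_stepAbs M (orbit M l i) with ⟨_, h', _⟩ | ⟨_, h'⟩
      · simp [h'] at h
      · simpa [h'] using h
  constructor
  · intro h
    have h' : (StateTransition.eval (TM0.step M) (TM0.init l)).Dom := h
    obtain ⟨h1, h2⟩ := StateTransition.mem_eval.1 (Part.get_mem h')
    obtain ⟨i, hi⟩ := horb _ h1
    refine ⟨i, ?_⟩
    rw [← hi] at h2
    rcases step_eq_stepAbs M (orbit M l i) with ⟨h, _⟩ | ⟨_, h⟩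
    · exact h
    · simp [h] at h2
  · rintro ⟨i, hi⟩
    have : (StateTransition.eval (TM0.step M) (TM0.init l)).Dom := by
      refine Part.dom_iff_mem.2 ⟨(orbit M l i).1, StateTransition.mem_eval.2 ⟨hreach i, ?_⟩⟩
      rcases step_eq_stepAbs M (orbit M l i) with ⟨_, h, _⟩ | ⟨h, _⟩
      · exact h
      · exact absurd hi h
    exact this

theorem Halted.mono {Γ Q : Type} [Inhabited Γ] [Inhabited Q] {M : TM0.Machine Γ Q} {l : List Γ}
    {i j : ℕ} (h : Halted M (orbit M l i)) (hij : i ≤ j) : Halted M (orbit M l j) := by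
  induction hij with
  | refl => exact h
  | step _ ih =>
    rw [orbit_succ]
    rcases step_eq_stepAbs M (orbit M l _) with ⟨_, _, h'⟩ | ⟨h', _⟩
    · rwa [h']
    · exact absurd ih h'

theorem abs_orbit_le {Γ Q : Type} [Inhabited Γ] [Inhabited Q] (M : TM0.Machine Γ Q) (l : List Γ)
    (i : ℕ) : |(orbit M l i).2| ≤ i := by
  induction i with
  | zero => simp [orbit]
  | succ i ih =>
    rw [orbit_succ]
    generalize orbit M l i = c at *
    rw [abs_le] at *
    push_cast
    unfold stepAbs
    split
    · omega
    · rename_i d _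
      cases d <;> simp only <;> omega
    · simp only; omega

/-- A word `a₀ … a_N` is a space-time diagram with row length `w` of a halting computation on
input `l`, where `o` is the initial head position in each row. -/
structure IsDiagram {Γ Q : Type} [Inhabited Γ] [Inhabited Q] (M : TM0.Machine Γ Q) (l : List Γ)
    (a : ℕ → Cell Γ Q) (N w o : ℕ) : Prop where
  pos : 1 ≤ o
  lt : o < w
  le : w ≤ N
  sep₀ : a 0 = none
  sep₁ : a w = none
  row : ∀ j, 1 ≤ j → j < w → a j = cellAt (TM0.init l, 0) (j - o)
  next : ∀ k, 1 ≤ k → k + w ≤ N → a (k + w) = nextCell M (a (k - 1)) (a k) (a (k + 1))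
  halt : HaltCell M (a N)

theorem IsDiagram.halts {Γ Q : Type} [Inhabited Γ] [Inhabited Q] {M : TM0.Machine Γ Q}
    {l : List Γ} {a : ℕ → Cell Γ Q} {N w o : ℕ} (h : IsDiagram M l a N w o) :
    (TM0.eval M l).Dom := by
  have hw := h.pos.trans_lt h.lt
  have hsep : ∀ i, i * w ≤ N → a (i * w) = none := by
    intro i
    induction i with
    | zero => intro _; simpa using h.sep₀
    | succ i ih =>
      intro hi
      rw [Nat.succ_mul] at hi ⊢
      rcases Nat.eq_zero_or_pos i with rfl | h0
      · simpa using h.sep₁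
      · rw [h.next _ (Nat.mul_pos h0 (by omega)) hi, ih (by omega)]
        rfl
  have hinv : ∀ i, ((1 ≤ o + (orbit M l i).2 ∧ o + (orbit M l i).2 < w) ∧
        ∀ j, 1 ≤ j → j < w → i * w + j ≤ N → a (i * w + j) = cellAt (orbit M l i) (j - o)) ∨
      ∀ j, j < w → i * w + j ≤ N → Headless (a (i * w + j)) := by
    intro i
    induction i with
    | zero =>
      left
      refine ⟨?_, fun j h1 h2 _ => by simpa [orbit] using h.row j h1 h2⟩
      have := h.pos
      have := h.lt
      simp only [orbit, Function.iterate_zero, id]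
      omega
    | succ i ih =>
      have e : ∀ j, (i + 1) * w + j = (i * w + j) + w := fun j => by ring
      have hs' : ∀ j, j = w → i * w + j ≤ N → a (i * w + j) = none := by
        rintro j rfl hj
        have := hsep (i + 1)
        rw [Nat.succ_mul] at this
        exact this hj
      rcases ih with ⟨hb, ih⟩ | ih
      · have hcell : ∀ j, 1 ≤ j → j < w → (i + 1) * w + j ≤ N →
            a ((i + 1) * w + j) = cellAt (orbit M l (i + 1)) (j - o) := by
          intro j h1 h2 hj
          rw [e] at hj ⊢
          rw [h.next _ (by omega) hj, ih j h1 h2 (by omega), orbit_succ]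
          apply nextCell_cellAt
          · rcases Nat.lt_or_ge 1 j with h3 | h3
            · have := ih (j - 1) (by omega) (by omega) (by omega)
              rw [show i * w + j - 1 = i * w + (j - 1) by omega, this]
              congr 2
              push_cast [h1]
              ring
            · obtain rfl : j = 1 := by omega
              rw [show i * w + 1 - 1 = i * w by omega, hsep i (by omega),
                (headless_cellAt (by push_cast; omega)).outgoing]
              rfl
          · rcases Nat.lt_or_ge (j + 1) w with h3 | h3
            · rw [show i * w + j + 1 = i * w + (j + 1) by omega, ih (j + 1) (by omega) h3 (by omega)]
              congr 2
              push_cast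
              ring
            · rw [show i * w + j + 1 = i * w + (j + 1) by omega, hs' (j + 1) (by omega) (by omega),
                (headless_cellAt (by omega)).outgoing]
              rfl
        by_cases hb' : 1 ≤ o + (orbit M l (i + 1)).2 ∧ o + (orbit M l (i + 1)).2 < w
        · exact Or.inl ⟨hb', hcell⟩
        · right
          intro j hj hjN
          rcases Nat.eq_zero_or_pos j with rfl | h0
          · rw [add_zero] at hjN ⊢
            rw [hsep _ hjN]
            simp [Headless]
          · rw [hcell j h0 hj hjN]
            exact headless_cellAt (by omega)
      · right
        intro j hj hjN
        rcases Nat.eq_zero_or_pos j with rfl | h0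
        · rw [add_zero] at hjN ⊢
          rw [hsep _ hjN]
          simp [Headless]
        · rw [e] at hjN ⊢
          rw [h.next _ (by omega) hjN]
          refine Headless.nextCell ?_ (ih j hj (by omega)) ?_
          · rw [show i * w + j - 1 = i * w + (j - 1) by omega]
            exact ih _ (by omega) (by omega)
          · rw [add_assoc]
            rcases Nat.lt_or_ge (j + 1) w with h3 | h3
            · exact ih _ h3 (by omega)
            · rw [hs' (j + 1) (by omega) (by omega)]
              simp [Headless]
  have hN : N / w * w + N % w = N := Nat.div_add_mod' N w
  have hlt : N % w < w := Nat.mod_lt _ (by omega)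
  have hH := h.halt
  rw [eval_dom_iff_halted]
  refine ⟨N / w, ?_⟩
  rcases Nat.eq_zero_or_pos (N % w) with h0 | h0
  · obtain ⟨s, q, hs, _⟩ := hH
    rw [h0, add_zero] at hN
    have := hsep (N / w) hN.le
    rw [hN, hs] at this
    cases this
  · rcases hinv (N / w) with ⟨_, h1⟩ | h1
    · have := h1 _ h0 hlt hN.le
      rw [hN] at this
      rw [this, haltCell_cellAt] at hH
      exact hH.2
    · obtain ⟨s, q, hs, _⟩ := hH
      have := h1 _ hlt hN.le
      rw [hN] at this
      exact absurd hs (this s q)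

theorem exists_isDiagram {Γ Q : Type} [Inhabited Γ] [Inhabited Q] {M : TM0.Machine Γ Q}
    {l : List Γ} (h : (TM0.eval M l).Dom) :
    ∃ (a : ℕ → Cell Γ Q) (N p : ℕ), IsDiagram M l a N (1 + p + l.length + p) (1 + p) := by
  obtain ⟨T₀, hT₀⟩ := (eval_dom_iff_halted M l).1 h
  obtain ⟨T, hT1, hT⟩ : ∃ T, 1 ≤ T ∧ Halted M (orbit M l T) :=
    ⟨T₀ + 1, by omega, hT₀.mono (by omega)⟩
  set p := T + 1 with hp
  set o := 1 + p with ho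
  set w := 1 + p + l.length + p with hw
  have hb := fun i => abs_le.1 (abs_orbit_le M l i)
  set a : ℕ → Cell Γ Q := fun k =>
    if k % w = 0 then none else cellAt (orbit M l (k / w)) ((k % w : ℕ) - o) with ha
  have ha' : ∀ i j, j < w → a (i * w + j) =
      if j = 0 then none else cellAt (orbit M l i) (j - o) := by
    intro i j hj
    have h1 : (i * w + j) % w = j := by rw [Nat.mul_add_mod', Nat.mod_eq_of_lt hj]
    have h2 : (i * w + j) / w = i := by
      rw [add_comm, Nat.add_mul_div_right _ _ (by omega), Nat.div_eq_of_lt hj, zero_add]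
    simp only [ha, h1, h2]
  obtain ⟨m, hm⟩ : ∃ m : ℕ, (m : ℤ) = o + (orbit M l T).2 :=
    ⟨(o + (orbit M l T).2).toNat, Int.toNat_of_nonneg (by have := hb T; omega)⟩
  have hm' := hb T
  refine ⟨a, T * w + m, p, by omega, by omega, ?_, by simp [ha], by simp [ha, ← hw], ?_, ?_, ?_⟩
  · nlinarith
  · intro j h1 h2
    have := ha' 0 j h2
    rw [zero_mul, zero_add] at this
    rw [this, if_neg (by omega)]
    rfl
  · intro k hk hkN
    have hk' : k / w * w + k % w = k := Nat.div_add_mod' k w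
    have hlt : k % w < w := Nat.mod_lt _ (by omega)
    have hiT : k / w < T := by
      by_contra hc
      have : T * w ≤ k / w * w := Nat.mul_le_mul_right _ (by omega)
      omega
    have hbi := hb (k / w)
    generalize k / w = i at *
    generalize k % w = j at *
    subst hk'
    rw [show i * w + j + w = (i + 1) * w + j by ring, ha' _ _ hlt, ha' _ _ hlt]
    split_ifs with h0
    · rfl
    · rw [orbit_succ]
      symm
      apply nextCell_cellAt
      · rw [show i * w + j - 1 = i * w + (j - 1) by omega, ha' _ _ (by omega)]
        split_ifs with h1
        · rw [(headless_cellAt (by omega)).outgoing]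
          rfl
        · congr 2
          push_cast [show 1 ≤ j by omega]
          ring
      · rcases Nat.lt_or_ge (j + 1) w with h3 | h3
        · rw [add_assoc, ha' _ _ h3, if_neg (by omega)]
          congr 2
          push_cast
          ring
        · rw [show i * w + j + 1 = (i + 1) * w + 0 by rw [Nat.succ_mul]; omega,
            ha' _ _ (by omega), if_pos rfl, (headless_cellAt (by omega)).outgoing]
          rfl
  · rw [ha' _ _ (by omega), if_neg (by omega), haltCell_cellAt]
    exact ⟨by omega, hT⟩

/-! ### The timed automaton of a machine and an input -/

section Automaton

variable {Γ Q : Type} [Fintype Γ] [Fintype Q] [Inhabited Γ] [Inhabited Q]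

/-- The proposition coding a cell. -/
noncomputable def cellCode (c : Cell Γ Q) : ℕ := 10 + (Fintype.equivFin (Cell Γ Q) c : ℕ)

omit [Inhabited Γ] [Inhabited Q] in
theorem cellCode_inj {c d : Cell Γ Q} : cellCode c = cellCode d ↔ c = d := by
  simp [cellCode, Fin.val_inj]

omit [Inhabited Γ] [Inhabited Q] in
theorem ten_le_cellCode (c : Cell Γ Q) : 10 ≤ cellCode c := Nat.le_add_right _ _

/-- The edges of the runs that measure unit distances. -/
def rulerEdges : List (PEdge ℕ) :=
  [(0, [1], [(0, .atom .gt 0)], [0], 1),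
   (1, [2], [], [1], 2),
   (2, [3], [(0, .atom .gt 1), (1, .atom .lt 1)], [], 3),
   (0, [4], [(0, .atom .gt 0)], [0], 4),
   (4, [5], [(0, .atom .lt 1)], [], 5),
   (5, [6], [(0, .atom .gt 1)], [], 3),
   (0, [7], [(0, .atom .gt 0)], [0], 6),
   (6, [8], [(0, .atom .eq 1)], [], 3)]

open Classical in
/-- The edges that do not depend on the length of the input. -/
noncomputable def fixedEdges (M : TM0.Machine Γ Q) (c₀ : Γ) : List (PEdge ℕ) :=
  rulerEdges ++
  [(0, [cellCode (none : Cell Γ Q)], [(0, .atom .gt 0)], [0], 7),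
   (7, [cellCode (some (default, none) : Cell Γ Q)], [], [], 7),
   (7, [cellCode (some (c₀, some default) : Cell Γ Q)], [], [], 8),
   (11, [cellCode (some (default, none) : Cell Γ Q)], [], [], 11),
   (11, [cellCode (none : Cell Γ Q)], [(0, .atom .eq 1)], [], 10)] ++
  (Finset.univ : Finset (Cell Γ Q)).toList.map (fun a => (10, [cellCode a], [], [], 10)) ++
  ((Finset.univ : Finset (Cell Γ Q)).filter (HaltCell M)).toList.map
    (fun a => (10, [cellCode a], [], [], 3))

/-- The fixed edges, together with the edges reading `n` copies of `b`. -/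
noncomputable def chainEdges (M : TM0.Machine Γ Q) (c₀ b : Γ) : ℕ → List (PEdge ℕ)
  | 0 => fixedEdges M c₀
  | j + 1 => (12 + j, [cellCode (some (b, none) : Cell Γ Q)], [], [], 11 + j) ::
      chainEdges M c₀ b j

/-- The automaton whose accepting runs are the rulers and the words that start with a row
containing the input `c₀ c₁ bⁿ` and end with a halting cell. -/
noncomputable def diagramPTA (M : TM0.Machine Γ Q) (c₀ c₁ b : Γ) (n : ℕ) : PTA ℕ where
  states := []
  start := 0
  props := []
  clocks := []
  trans := (8, [cellCode (some (c₁, none) : Cell Γ Q)], [], [], 11 + n) :: chainEdges M c₀ b n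
  final := [3]

/-- The edges of `diagramPTA` labeled by cells. -/
inductive WordEdge (M : TM0.Machine Γ Q) (c₀ c₁ b : Γ) (n : ℕ) : PEdge ℕ → Prop
  | first : WordEdge M c₀ c₁ b n
      (0, [cellCode (none : Cell Γ Q)], [(0, .atom .gt 0)], [0], 7)
  | padLeft : WordEdge M c₀ c₁ b n (7, [cellCode (some (default, none) : Cell Γ Q)], [], [], 7)
  | head : WordEdge M c₀ c₁ b n (7, [cellCode (some (c₀, some default) : Cell Γ Q)], [], [], 8)
  | second : WordEdge M c₀ c₁ b n (8, [cellCode (some (c₁, none) : Cell Γ Q)], [], [], 11 + n)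
  | input (j : ℕ) (hj : j < n) : WordEdge M c₀ c₁ b n
      (12 + j, [cellCode (some (b, none) : Cell Γ Q)], [], [], 11 + j)
  | padRight : WordEdge M c₀ c₁ b n
      (11, [cellCode (some (default, none) : Cell Γ Q)], [], [], 11)
  | sep : WordEdge M c₀ c₁ b n (11, [cellCode (none : Cell Γ Q)], [(0, .atom .eq 1)], [], 10)
  | cell (a : Cell Γ Q) : WordEdge M c₀ c₁ b n (10, [cellCode a], [], [], 10)
  | halt (a : Cell Γ Q) (ha : HaltCell M a) : WordEdge M c₀ c₁ b n (10, [cellCode a], [], [], 3)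

variable {M : TM0.Machine Γ Q} {c₀ c₁ b : Γ} {n : ℕ}

theorem mem_fixedEdges {e : PEdge ℕ} (h : e ∈ fixedEdges M c₀) :
    e ∈ rulerEdges ∨ WordEdge M c₀ c₁ b n e := by
  simp only [fixedEdges, List.mem_append, List.mem_map, Finset.mem_toList, Finset.mem_univ,
    true_and, Finset.mem_filter, List.mem_cons, List.not_mem_nil, or_false] at h
  rcases h with ((h | rfl | rfl | rfl | rfl | rfl) | ⟨a, rfl⟩) | ⟨a, ha, rfl⟩
  · exact Or.inl h
  all_goals right; constructor
  exact ha

theorem mem_trans_diagramPTA {e : PEdge ℕ} :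
    e ∈ (diagramPTA M c₀ c₁ b n).trans ↔ e ∈ rulerEdges ∨ WordEdge M c₀ c₁ b n e := by
  have hfix : ∀ m, ∀ e ∈ fixedEdges M c₀, e ∈ chainEdges M c₀ b m := by
    intro m
    induction m with
    | zero => exact fun e h => h
    | succ m ih => exact fun e h => List.mem_cons_of_mem _ (ih e h)
  constructor
  · intro h
    rcases List.mem_cons.1 h with rfl | h
    · exact Or.inr .second
    · have : ∀ m ≤ n, e ∈ chainEdges M c₀ b m → e ∈ rulerEdges ∨ WordEdge M c₀ c₁ b n e := by
        intro m
        induction m with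
        | zero => exact fun _ => mem_fixedEdges
        | succ m ih =>
          intro hm h
          rcases List.mem_cons.1 h with rfl | h
          · exact Or.inr (.input m hm)
          · exact ih (by omega) h
      exact this n le_rfl h
  · rintro (h | h)
    · exact List.mem_cons_of_mem _ (hfix _ _ (by simp [fixedEdges, h]))
    · cases h with
      | second => exact List.mem_cons_self
      | input j hj =>
        refine List.mem_cons_of_mem _ ?_
        induction n with
        | zero => omega
        | succ m ih =>
          rcases Nat.lt_succ_iff_lt_or_eq.1 hj with h | rfl
          · exact List.mem_cons_of_mem _ (ih h)
          · exact List.mem_cons_self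
      | halt a ha => exact List.mem_cons_of_mem _ (hfix _ _ (by
          simp only [fixedEdges, List.mem_append, List.mem_map]
          exact Or.inr ⟨a, by simp [ha], rfl⟩))
      | cell a => exact List.mem_cons_of_mem _ (hfix _ _ (by simp [fixedEdges]))
      | _ => exact List.mem_cons_of_mem _ (hfix _ _ (by simp [fixedEdges]))

theorem WordEdge.exists_event {e : PEdge ℕ} (h : WordEdge M c₀ c₁ b n e) :
    ∃ a : Cell Γ Q, e.event = [cellCode a] := by
  cases h <;> exact ⟨_, rfl⟩

theorem WordEdge.src_mem {e : PEdge ℕ} (h : WordEdge M c₀ c₁ b n e) :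
    e.src = 0 ∨ 7 ≤ e.src := by
  cases h <;> simp [PEdge.src]
  omega

theorem WordEdge.dst_mem {e : PEdge ℕ} (h : WordEdge M c₀ c₁ b n e) :
    e.dst = 3 ∨ 7 ≤ e.dst := by
  cases h <;> simp [PEdge.dst] <;> omega

theorem mem_rulerEdges {e : PEdge ℕ} : e ∈ rulerEdges ↔
    e = (0, [1], [(0, .atom .gt 0)], [0], 1) ∨ e = (1, [2], [], [1], 2) ∨
    e = (2, [3], [(0, .atom .gt 1), (1, .atom .lt 1)], [], 3) ∨
    e = (0, [4], [(0, .atom .gt 0)], [0], 4) ∨ e = (4, [5], [(0, .atom .lt 1)], [], 5) ∨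
    e = (5, [6], [(0, .atom .gt 1)], [], 3) ∨ e = (0, [7], [(0, .atom .gt 0)], [0], 6) ∨
    e = (6, [8], [(0, .atom .eq 1)], [], 3) := by
  simp [rulerEdges]

/-- An edge of `diagramPTA` is determined by a label of a ruler. -/
theorem eq_of_mem_event {e : PEdge ℕ} (h : e ∈ (diagramPTA M c₀ c₁ b n).trans) {p : ℕ}
    (hp : p ∈ e.event) (hp' : p < 10) : e ∈ rulerEdges ∧ e.event = [p] := by
  rcases mem_trans_diagramPTA.1 h with h | h
  · refine ⟨h, ?_⟩
    rcases mem_rulerEdges.1 h with rfl | rfl | rfl | rfl | rfl | rfl | rfl | rfl <;>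
      simpa [PEdge.event, eq_comm] using hp
  · obtain ⟨a, ha⟩ := h.exists_event
    have := ten_le_cellCode a
    rw [ha, List.mem_singleton] at hp
    omega

/-- An edge of `diagramPTA` out of an inner ruler state is a ruler edge. -/
theorem mem_rulerEdges_of_src {e : PEdge ℕ} (h : e ∈ (diagramPTA M c₀ c₁ b n).trans)
    (h0 : e.src ≠ 0) (h7 : e.src < 7) : e ∈ rulerEdges := by
  rcases mem_trans_diagramPTA.1 h with h | h
  · exact h
  · have := h.src_mem
    omega

theorem dst_ne_zero {e : PEdge ℕ} (h : e ∈ (diagramPTA M c₀ c₁ b n).trans) : e.dst ≠ 0 := by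
  rcases mem_trans_diagramPTA.1 h with h | h
  · rcases mem_rulerEdges.1 h with rfl | rfl | rfl | rfl | rfl | rfl | rfl | rfl <;>
      simp [PEdge.dst]
  · have := h.dst_mem
    omega

theorem src_ne_three {e : PEdge ℕ} (h : e ∈ (diagramPTA M c₀ c₁ b n).trans) : e.src ≠ 3 := by
  rcases mem_trans_diagramPTA.1 h with h | h
  · rcases mem_rulerEdges.1 h with rfl | rfl | rfl | rfl | rfl | rfl | rfl | rfl <;>
      simp [PEdge.src]
  · have := h.src_mem
    omega

end Automaton

/-! ### Runs -/

namespace PRun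

variable {η : PRun ℕ} {B : PTA ℕ}

theorem IsRun.time_lt (h : η.IsRun natR B) {i j : ℕ} (hij : i < j) (hj : j < η.n) :
    η.time i < η.time j := by
  induction j, hij using Nat.le_induction with
  | base => exact h.2.2.2.1 i hj
  | succ j hij ih => exact (ih (by omega)).trans (h.2.2.2.1 j hj)

theorem IsRun.time_le (h : η.IsRun natR B) {i j : ℕ} (hij : i ≤ j) (hj : j < η.n) :
    η.time i ≤ η.time j := by
  rcases hij.eq_or_lt with rfl | hij
  · exact le_rfl
  · exact (h.time_lt hij hj).le

theorem IsRun.time_lt_iff (h : η.IsRun natR B) {i j : ℕ} (hi : i < η.n) (hj : j < η.n) :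
    η.time i < η.time j ↔ i < j := by
  constructor
  · intro hlt
    by_contra hc
    exact absurd (h.time_le (not_lt.1 hc) hi) (not_le.2 hlt)
  · exact fun hij => h.time_lt hij hj

theorem IsRun.time_inj (h : η.IsRun natR B) {i j : ℕ} (hi : i < η.n) (hj : j < η.n)
    (e : η.time i = η.time j) : i = j := by
  rcases lt_trichotomy i j with hij | hij | hij
  · exact absurd e (h.time_lt hij hj).ne
  · exact hij
  · exact absurd e (h.time_lt hij hi).ne'

theorem mu_zero_add (x : ℕ) : η.mu 0 x + (η.time 0 - η.tprev 0) = η.time 0 := by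
  simp [mu, tprev]

/-- The value of a clock is the time since its last reset. -/
theorem mu_add_eq {r i x : ℕ} (hri : r < i) (hr : x ∈ (η.edge r).rst)
    (hx : ∀ j, r < j → j < i → x ∉ (η.edge j).rst) :
    η.mu i x + (η.time i - η.tprev i) = η.time i - η.time r := by
  induction i, hri using Nat.le_induction with
  | base => simp [mu, hr, tprev]
  | succ i hri ih =>
    have h1 := ih fun j h1 h2 => hx j h1 (by omega)
    have h2 : η.mu (i + 1) x = η.mu i x + (η.time i - η.tprev i) := by
      simp only [mu, if_neg (hx i hri (by omega))]
    have h3 : η.tprev (i + 1) = η.time i := by simp [tprev]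
    rw [h2, h3, h1]
    ring

end PRun

/-! ### Accepting runs of the automaton -/

section AccRuns

variable {Γ Q : Type} [Fintype Γ] [Fintype Q] [Inhabited Γ] [Inhabited Q]
  {M : TM0.Machine Γ Q} {c₀ c₁ b : Γ} {n : ℕ} {η : PRun ℕ}

theorem run_edge_mem (h : η.IsAccRun natR (diagramPTA M c₀ c₁ b n)) {i : ℕ} (hi : i < η.n) :
    η.edge i ∈ (diagramPTA M c₀ c₁ b n).trans :=
  h.1.2.2.2.2.2.1 i hi

theorem run_src_succ (h : η.IsAccRun natR (diagramPTA M c₀ c₁ b n)) {i : ℕ}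
    (hi : i + 1 < η.n) : (η.edge (i + 1)).src = (η.edge i).dst :=
  h.1.2.2.2.2.2.2.1 i hi

theorem run_src_zero (h : η.IsAccRun natR (diagramPTA M c₀ c₁ b n)) : (η.edge 0).src = 0 :=
  h.1.2.2.2.2.1

theorem run_guard (h : η.IsAccRun natR (diagramPTA M c₀ c₁ b n)) {i : ℕ} (hi : i < η.n)
    {q : ℕ × ClkC ℕ} (hq : q ∈ (η.edge i).guard) :
    q.2.holds natR (η.mu i q.1 + (η.time i - η.tprev i)) :=
  h.1.2.2.2.2.2.2.2 i hi q hq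

theorem run_succ_lt (h : η.IsAccRun natR (diagramPTA M c₀ c₁ b n)) {i : ℕ} (hi : i < η.n)
    (hd : (η.edge i).dst ≠ 3) : i + 1 < η.n := by
  by_contra hc
  obtain rfl : i = η.n - 1 := by omega
  exact hd (by simpa [diagramPTA] using h.2)

theorem run_eq_of_dst (h : η.IsAccRun natR (diagramPTA M c₀ c₁ b n)) {i : ℕ} (hi : i < η.n)
    (hd : (η.edge i).dst = 3) : i + 1 = η.n := by
  by_contra hc
  have hi' : i + 1 < η.n := by omega
  exact src_ne_three (run_edge_mem h hi') ((run_src_succ h hi').trans hd)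

theorem run_eq_zero_of_src (h : η.IsAccRun natR (diagramPTA M c₀ c₁ b n)) {i : ℕ}
    (hi : i < η.n) (hs : (η.edge i).src = 0) : i = 0 := by
  rcases i with _ | i
  · rfl
  · rw [run_src_succ h hi] at hs
    exact absurd hs (dst_ne_zero (run_edge_mem h (by omega)))

theorem run_guard_zero (h : η.IsAccRun natR (diagramPTA M c₀ c₁ b n)) :
    (η.edge 0).guard = [(0, .atom .gt 0)] ∧ (η.edge 0).rst = [0] := by
  have h0 := run_src_zero h
  rcases mem_trans_diagramPTA.1 (run_edge_mem h h.1.1) with he | he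
  · generalize η.edge 0 = e at h0 he
    rcases mem_rulerEdges.1 he with rfl | rfl | rfl | rfl | rfl | rfl | rfl | rfl <;>
      simp_all [PEdge.src, PEdge.guard, PEdge.rst]
  · generalize η.edge 0 = e at h0 he
    cases he <;> simp_all [PEdge.src, PEdge.guard, PEdge.rst]

theorem run_time_pos (h : η.IsAccRun natR (diagramPTA M c₀ c₁ b n)) {i : ℕ} (hi : i < η.n) :
    0 < η.time i := by
  have := run_guard h h.1.1 (q := (0, .atom .gt 0)) (by simp [(run_guard_zero h).1])
  rw [PRun.mu_zero_add] at this
  refine lt_of_lt_of_le ?_ (h.1.time_le (Nat.zero_le i) hi)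
  simpa [ClkC.holds, Cmp.denote, natR] using this

/-- A step of a run inside a ruler. -/
theorem run_ruler_succ (h : η.IsAccRun natR (diagramPTA M c₀ c₁ b n)) {i s : ℕ} (hi : i < η.n)
    (hd : (η.edge i).dst = s) (h0 : s ≠ 0) (h3 : s ≠ 3) (h7 : s < 7) :
    i + 1 < η.n ∧ (η.edge (i + 1)).src = s ∧ η.edge (i + 1) ∈ rulerEdges := by
  have hi' := run_succ_lt h hi (by omega)
  have hs := (run_src_succ h hi').trans hd
  exact ⟨hi', hs, mem_rulerEdges_of_src (run_edge_mem h hi') (by omega) (by omega)⟩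

theorem run_of_one_mem (h : η.IsAccRun natR (diagramPTA M c₀ c₁ b n)) {i : ℕ} (hi : i < η.n)
    (h1 : 1 ∈ (η.edge i).event) :
    i = 0 ∧ η.n = 3 ∧ (η.edge 0).event = [1] ∧ (η.edge 1).event = [2] ∧
      (η.edge 2).event = [3] ∧ 1 < η.time 2 - η.time 0 ∧ η.time 2 - η.time 1 < 1 := by
  obtain ⟨he, hev⟩ := eq_of_mem_event (run_edge_mem h hi) h1 (by omega)
  have e0 : η.edge i = (0, [1], [(0, .atom .gt 0)], [0], 1) := by
    generalize η.edge i = e at *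
    rcases mem_rulerEdges.1 he with rfl | rfl | rfl | rfl | rfl | rfl | rfl | rfl <;>
      simp_all [PEdge.event]
  obtain rfl := run_eq_zero_of_src h hi (by rw [e0]; rfl)
  obtain ⟨hn1, hs1, he1⟩ := run_ruler_succ h hi (by rw [e0]; rfl : _ = 1) (by omega) (by omega)
    (by omega)
  have e1 : η.edge 1 = (1, [2], [], [1], 2) := by
    generalize η.edge (0 + 1) = e at *
    rcases mem_rulerEdges.1 he1 with rfl | rfl | rfl | rfl | rfl | rfl | rfl | rfl <;>
      simp_all [PEdge.src]
  obtain ⟨hn2, hs2, he2⟩ := run_ruler_succ h hn1 (by rw [e1]; rfl : _ = 2) (by omega) (by omega)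
    (by omega)
  have e2 : η.edge 2 = (2, [3], [(0, .atom .gt 1), (1, .atom .lt 1)], [], 3) := by
    generalize η.edge (0 + 1 + 1) = e at *
    rcases mem_rulerEdges.1 he2 with rfl | rfl | rfl | rfl | rfl | rfl | rfl | rfl <;>
      simp_all [PEdge.src]
  have hn3 := run_eq_of_dst h hn2 (by rw [e2]; rfl)
  have g0 := run_guard h hn2 (q := (0, .atom .gt 1)) (by simp [e2, PEdge.guard])
  have g1 := run_guard h hn2 (q := (1, .atom .lt 1)) (by simp [e2, PEdge.guard])
  rw [PRun.mu_add_eq (r := 0) (by omega) (by simp [e0, PEdge.rst])] at g0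
  · rw [PRun.mu_add_eq (r := 1) (by omega) (by simp [e1, PEdge.rst]) (by omega)] at g1
    refine ⟨rfl, hn3.symm, by rw [e0]; rfl, by rw [e1]; rfl, by rw [e2]; rfl, ?_, ?_⟩
    · simpa [ClkC.holds, Cmp.denote, natR] using g0
    · simpa [ClkC.holds, Cmp.denote, natR] using g1
  · intro j hj hj'
    obtain rfl : j = 1 := by omega
    simp [e1, PEdge.rst]

theorem run_of_four_mem (h : η.IsAccRun natR (diagramPTA M c₀ c₁ b n)) {i : ℕ} (hi : i < η.n)
    (h1 : 4 ∈ (η.edge i).event) :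
    i = 0 ∧ η.n = 3 ∧ (η.edge 0).event = [4] ∧ (η.edge 1).event = [5] ∧
      (η.edge 2).event = [6] ∧ η.time 1 - η.time 0 < 1 ∧ 1 < η.time 2 - η.time 0 := by
  obtain ⟨he, hev⟩ := eq_of_mem_event (run_edge_mem h hi) h1 (by omega)
  have e0 : η.edge i = (0, [4], [(0, .atom .gt 0)], [0], 4) := by
    generalize η.edge i = e at *
    rcases mem_rulerEdges.1 he with rfl | rfl | rfl | rfl | rfl | rfl | rfl | rfl <;>
      simp_all [PEdge.event]
  obtain rfl := run_eq_zero_of_src h hi (by rw [e0]; rfl)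
  obtain ⟨hn1, hs1, he1⟩ := run_ruler_succ h hi (by rw [e0]; rfl : _ = 4) (by omega) (by omega)
    (by omega)
  have e1 : η.edge 1 = (4, [5], [(0, .atom .lt 1)], [], 5) := by
    generalize η.edge (0 + 1) = e at *
    rcases mem_rulerEdges.1 he1 with rfl | rfl | rfl | rfl | rfl | rfl | rfl | rfl <;>
      simp_all [PEdge.src]
  obtain ⟨hn2, hs2, he2⟩ := run_ruler_succ h hn1 (by rw [e1]; rfl : _ = 5) (by omega) (by omega)
    (by omega)
  have e2 : η.edge 2 = (5, [6], [(0, .atom .gt 1)], [], 3) := by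
    generalize η.edge (0 + 1 + 1) = e at *
    rcases mem_rulerEdges.1 he2 with rfl | rfl | rfl | rfl | rfl | rfl | rfl | rfl <;>
      simp_all [PEdge.src]
  have hn3 := run_eq_of_dst h hn2 (by rw [e2]; rfl)
  have g0 := run_guard h hn1 (q := (0, .atom .lt 1)) (by simp [e1, PEdge.guard])
  have g1 := run_guard h hn2 (q := (0, .atom .gt 1)) (by simp [e2, PEdge.guard])
  rw [PRun.mu_add_eq (r := 0) (by omega) (by simp [e0, PEdge.rst]) (by omega)] at g0
  rw [PRun.mu_add_eq (r := 0) (by omega) (by simp [e0, PEdge.rst])] at g1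
  · refine ⟨rfl, hn3.symm, by rw [e0]; rfl, by rw [e1]; rfl, by rw [e2]; rfl, ?_, ?_⟩
    · simpa [ClkC.holds, Cmp.denote, natR] using g0
    · simpa [ClkC.holds, Cmp.denote, natR] using g1
  · intro j hj hj'
    obtain rfl : j = 1 := by omega
    simp [e1, PEdge.rst]

theorem run_of_seven_mem (h : η.IsAccRun natR (diagramPTA M c₀ c₁ b n)) {i : ℕ} (hi : i < η.n)
    (h1 : 7 ∈ (η.edge i).event) :
    i = 0 ∧ η.n = 2 ∧ (η.edge 0).event = [7] ∧ (η.edge 1).event = [8] ∧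
      η.time 1 = η.time 0 + 1 := by
  obtain ⟨he, hev⟩ := eq_of_mem_event (run_edge_mem h hi) h1 (by omega)
  have e0 : η.edge i = (0, [7], [(0, .atom .gt 0)], [0], 6) := by
    generalize η.edge i = e at *
    rcases mem_rulerEdges.1 he with rfl | rfl | rfl | rfl | rfl | rfl | rfl | rfl <;>
      simp_all [PEdge.event]
  obtain rfl := run_eq_zero_of_src h hi (by rw [e0]; rfl)
  obtain ⟨hn1, hs1, he1⟩ := run_ruler_succ h hi (by rw [e0]; rfl : _ = 6) (by omega) (by omega)
    (by omega)
  have e1 : η.edge 1 = (6, [8], [(0, .atom .eq 1)], [], 3) := by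
    generalize η.edge (0 + 1) = e at *
    rcases mem_rulerEdges.1 he1 with rfl | rfl | rfl | rfl | rfl | rfl | rfl | rfl <;>
      simp_all [PEdge.src]
  have hn2 := run_eq_of_dst h hn1 (by rw [e1]; rfl)
  have g0 := run_guard h hn1 (q := (0, .atom .eq 1)) (by simp [e1, PEdge.guard])
  rw [PRun.mu_add_eq (r := 0) (by omega) (by simp [e0, PEdge.rst]) (by omega)] at g0
  refine ⟨rfl, hn2.symm, by rw [e0]; rfl, by rw [e1]; rfl, ?_⟩
  have : η.time 1 - η.time 0 = 1 := by simpa [ClkC.holds, Cmp.denote, natR] using g0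
  linarith

theorem ruler_mem {e : PEdge ℕ} (h : e ∈ rulerEdges) : e ∈ (diagramPTA M c₀ c₁ b n).trans :=
  mem_trans_diagramPTA.2 (Or.inl h)

theorem exists_run_one {s t u : ℝ} (hs : 0 < s) (hst : s < t) (htu : t < u) (h1 : 1 < u - s)
    (h2 : u - t < 1) : ∃ η : PRun ℕ, η.IsAccRun natR (diagramPTA M c₀ c₁ b n) ∧ η.n = 3 ∧
      (η.edge 0).event = [1] ∧ (η.edge 1).event = [2] ∧ (η.edge 2).event = [3] ∧
      η.time 0 = s ∧ η.time 1 = t ∧ η.time 2 = u := by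
  refine ⟨⟨[(0, [1], [(0, .atom .gt 0)], [0], 1), (1, [2], [], [1], 2),
    (2, [3], [(0, .atom .gt 1), (1, .atom .lt 1)], [], 3)], [s, t, u]⟩,
    ⟨⟨?_, rfl, hs.le, ?_, rfl, ?_, ?_, ?_⟩, ?_⟩, rfl, rfl, rfl, rfl, rfl, rfl, rfl⟩
  · simp [PRun.n]
  · intro i hi
    simp only [PRun.n, List.length_cons, List.length_nil] at hi
    obtain rfl | rfl : i = 0 ∨ i = 1 := by omega
    exacts [hst, htu]
  · intro i hi
    apply ruler_mem
    simp only [PRun.n, List.length_cons, List.length_nil] at hi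
    obtain rfl | rfl | rfl : i = 0 ∨ i = 1 ∨ i = 2 := by omega
    all_goals simp [PRun.edge, rulerEdges]
  · intro i hi
    simp only [PRun.n, List.length_cons, List.length_nil] at hi
    obtain rfl | rfl : i = 0 ∨ i = 1 := by omega
    all_goals rfl
  · intro i hi
    simp only [PRun.n, List.length_cons, List.length_nil] at hi
    obtain rfl | rfl | rfl : i = 0 ∨ i = 1 ∨ i = 2 := by omega
    all_goals
      simp [PRun.edge, PRun.time, PRun.tprev, PRun.mu, PEdge.guard, PEdge.rst, ClkC.holds,
        Cmp.denote, natR]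
    · exact hs
    · constructor <;> linarith
  · simp [PRun.edge, PRun.n, PEdge.dst, diagramPTA]

theorem exists_run_four {s t u : ℝ} (hs : 0 < s) (hst : s < t) (htu : t < u) (h1 : t - s < 1)
    (h2 : 1 < u - s) : ∃ η : PRun ℕ, η.IsAccRun natR (diagramPTA M c₀ c₁ b n) ∧ η.n = 3 ∧
      (η.edge 0).event = [4] ∧ (η.edge 1).event = [5] ∧ (η.edge 2).event = [6] ∧
      η.time 0 = s ∧ η.time 1 = t ∧ η.time 2 = u := by
  refine ⟨⟨[(0, [4], [(0, .atom .gt 0)], [0], 4), (4, [5], [(0, .atom .lt 1)], [], 5),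
    (5, [6], [(0, .atom .gt 1)], [], 3)], [s, t, u]⟩,
    ⟨⟨?_, rfl, hs.le, ?_, rfl, ?_, ?_, ?_⟩, ?_⟩, rfl, rfl, rfl, rfl, rfl, rfl, rfl⟩
  · simp [PRun.n]
  · intro i hi
    simp only [PRun.n, List.length_cons, List.length_nil] at hi
    obtain rfl | rfl : i = 0 ∨ i = 1 := by omega
    exacts [hst, htu]
  · intro i hi
    apply ruler_mem
    simp only [PRun.n, List.length_cons, List.length_nil] at hi
    obtain rfl | rfl | rfl : i = 0 ∨ i = 1 ∨ i = 2 := by omega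
    all_goals simp [PRun.edge, rulerEdges]
  · intro i hi
    simp only [PRun.n, List.length_cons, List.length_nil] at hi
    obtain rfl | rfl : i = 0 ∨ i = 1 := by omega
    all_goals rfl
  · intro i hi
    simp only [PRun.n, List.length_cons, List.length_nil] at hi
    obtain rfl | rfl | rfl : i = 0 ∨ i = 1 ∨ i = 2 := by omega
    all_goals
      simp [PRun.edge, PRun.time, PRun.tprev, PRun.mu, PEdge.guard, PEdge.rst, ClkC.holds,
        Cmp.denote, natR]
    · exact hs
    · linarith
    · linarith
  · simp [PRun.edge, PRun.n, PEdge.dst, diagramPTA]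

theorem exists_run_seven {s : ℝ} (hs : 0 < s) :
    ∃ η : PRun ℕ, η.IsAccRun natR (diagramPTA M c₀ c₁ b n) ∧ η.n = 2 ∧
      (η.edge 0).event = [7] ∧ (η.edge 1).event = [8] ∧
      η.time 0 = s ∧ η.time 1 = s + 1 := by
  refine ⟨⟨[(0, [7], [(0, .atom .gt 0)], [0], 6), (6, [8], [(0, .atom .eq 1)], [], 3)],
    [s, s + 1]⟩,
    ⟨⟨?_, rfl, hs.le, ?_, rfl, ?_, ?_, ?_⟩, ?_⟩, rfl, rfl, rfl, rfl, rfl⟩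
  · simp [PRun.n]
  · intro i hi
    simp only [PRun.n, List.length_cons, List.length_nil] at hi
    obtain rfl : i = 0 := by omega
    simp [PRun.time]
  · intro i hi
    apply ruler_mem
    simp only [PRun.n, List.length_cons, List.length_nil] at hi
    obtain rfl | rfl : i = 0 ∨ i = 1 := by omega
    all_goals simp [PRun.edge, rulerEdges]
  · intro i hi
    simp only [PRun.n, List.length_cons, List.length_nil] at hi
    obtain rfl : i = 0 := by omega
    rfl
  · intro i hi
    simp only [PRun.n, List.length_cons, List.length_nil] at hi
    obtain rfl | rfl : i = 0 ∨ i = 1 := by omega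
    all_goals
      simp [PRun.edge, PRun.time, PRun.tprev, PRun.mu, PEdge.guard, PEdge.rst, ClkC.holds,
        Cmp.denote, natR]
    exact hs
  · simp [PRun.edge, PRun.n, PEdge.dst, diagramPTA]

end AccRuns

/-! ### Runs reading words -/

theorem nth_mk₁ {Γ : Type} [Inhabited Γ] (l : List Γ) (k : ℕ) :
    (Tape.mk₁ l).nth (k : ℤ) = l.getI k := by
  rw [Tape.mk₁, Tape.mk₂, Tape.mk'_nth_nat, ListBlank.nth_mk]

theorem nth_mk₁_neg {Γ : Type} [Inhabited Γ] (l : List Γ) {z : ℤ} (hz : z < 0) :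
    (Tape.mk₁ l).nth z = default := by
  obtain ⟨k, rfl⟩ : ∃ k : ℕ, z = -(k + 1 : ℤ) := ⟨(-z - 1).toNat, by omega⟩
  rw [← Int.negSucc_eq]
  simp [Tape.mk₁, Tape.mk₂, Tape.mk', Tape.nth]

section Init

variable {Γ : Type} (Q : Type) [Inhabited Γ] [Inhabited Q] (c₀ c₁ b : Γ) (n : ℕ)

/-- The cell at position `z` of the initial configuration on input `c₀ c₁ bⁿ`. -/
def initCell (z : ℤ) : Cell Γ Q :=
  cellAt (TM0.init (c₀ :: c₁ :: List.replicate n b), 0) z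

theorem initCell_neg {z : ℤ} (hz : z < 0) : initCell Q c₀ c₁ b n z = some (default, none) := by
  simp [initCell, cellAt, TM0.init, nth_mk₁_neg _ hz, hz.ne]

theorem initCell_zero : initCell Q c₀ c₁ b n 0 = some (c₀, some default) := by
  have := nth_mk₁ (c₀ :: c₁ :: List.replicate n b) 0
  simp_all [initCell, cellAt, TM0.init]

theorem initCell_one : initCell Q c₀ c₁ b n 1 = some (c₁, none) := by
  have := nth_mk₁ (c₀ :: c₁ :: List.replicate n b) 1
  simp_all [initCell, cellAt, TM0.init, List.getI]

theorem initCell_input {z : ℤ} (hz : 2 ≤ z) (hz' : z < n + 2) :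
    initCell Q c₀ c₁ b n z = some (b, none) := by
  obtain ⟨k, rfl⟩ : ∃ k : ℕ, z = ((k + 2 : ℕ) : ℤ) := ⟨(z - 2).toNat, by omega⟩
  have := nth_mk₁ (c₀ :: c₁ :: List.replicate n b) (k + 2)
  have hk : k < n := by omega
  have hne : ((k + 2 : ℕ) : ℤ) ≠ 0 := by omega
  simp only [initCell, cellAt, TM0.init, sub_zero, this, if_neg hne]
  simp [List.getI, hk]

theorem initCell_right {z : ℤ} (hz : n + 2 ≤ z) :
    initCell Q c₀ c₁ b n z = some (default, none) := by
  obtain ⟨k, rfl⟩ : ∃ k : ℕ, z = ((k + 2 : ℕ) : ℤ) := ⟨(z - 2).toNat, by omega⟩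
  have := nth_mk₁ (c₀ :: c₁ :: List.replicate n b) (k + 2)
  have hk : n ≤ k := by omega
  have hne : ((k + 2 : ℕ) : ℤ) ≠ 0 := by omega
  simp only [initCell, cellAt, TM0.init, sub_zero, this, if_neg hne]
  simp [List.getI, hk]

end Init

section Words

variable {Γ Q : Type} [Fintype Γ] [Fintype Q] [Inhabited Γ] [Inhabited Q]
  {M : TM0.Machine Γ Q} {c₀ c₁ b : Γ} {n : ℕ} {η : PRun ℕ}

theorem run_wordEdge (h : η.IsAccRun natR (diagramPTA M c₀ c₁ b n))
    (h0 : WordEdge M c₀ c₁ b n (η.edge 0)) {i : ℕ} (hi : i < η.n) :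
    WordEdge M c₀ c₁ b n (η.edge i) := by
  induction i with
  | zero => exact h0
  | succ i ih =>
    have hs := run_src_succ h hi
    have hd := (ih (by omega)).dst_mem
    have h3 := src_ne_three (run_edge_mem h hi)
    rcases mem_trans_diagramPTA.1 (run_edge_mem h hi) with he | he
    · have : (η.edge (i + 1)).src < 7 := by
        generalize η.edge (i + 1) = e at he
        rcases mem_rulerEdges.1 he with rfl | rfl | rfl | rfl | rfl | rfl | rfl | rfl <;>
          simp [PEdge.src]
      omega
    · exact he

theorem run_exists_word (h : η.IsAccRun natR (diagramPTA M c₀ c₁ b n))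
    (h0 : WordEdge M c₀ c₁ b n (η.edge 0)) :
    ∃ a : ℕ → Cell Γ Q, ∀ i < η.n, (η.edge i).event = [cellCode (a i)] := by
  have : ∀ i, ∃ c : Cell Γ Q, i < η.n → (η.edge i).event = [cellCode c] := fun i => by
    by_cases hi : i < η.n
    · obtain ⟨c, hc⟩ := (run_wordEdge h h0 hi).exists_event
      exact ⟨c, fun _ => hc⟩
    · exact ⟨none, fun h => absurd h hi⟩
  choose a ha using this
  exact ⟨a, ha⟩

/-- What is known of a word `a`, with `tw w` saying that position `w` is one time unit after the
start, when a run reaches state `s` before position `i`. -/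
structure WordInv (c₀ c₁ b : Γ) (n : ℕ) (a : ℕ → Cell Γ Q) (tw : ℕ → Prop) (i s : ℕ) : Prop where
  start : s = 0 → i = 0
  sep : s ≠ 0 → 1 ≤ i ∧ a 0 = none
  left : s = 7 → ∀ j, 1 ≤ j → j < i → a j = some (default, none)
  head : s = 8 → 2 ≤ i ∧ ∀ j : ℕ, 1 ≤ j → j < i → a j = initCell Q c₀ c₁ b n (j - (i - 1))
  tail : 11 ≤ s → s ≤ 11 + n ∧ ∃ o, 1 ≤ o ∧ (o + 2 + n + 11 = i + s ∨ s = 11 ∧ o + 2 + n ≤ i) ∧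
    ∀ j : ℕ, 1 ≤ j → j < i → a j = initCell Q c₀ c₁ b n (j - o)
  next : s = 10 → ∃ w o, 1 ≤ o ∧ o < w ∧ w < i ∧ a w = none ∧ tw w ∧
    ∀ j : ℕ, 1 ≤ j → j < w → a j = initCell Q c₀ c₁ b n (j - o)

theorem WordInv.succ {a : ℕ → Cell Γ Q} {tw : ℕ → Prop} {i : ℕ} {e : PEdge ℕ}
    (h : WordInv c₀ c₁ b n a tw i e.src) (he : WordEdge M c₀ c₁ b n e)
    (ha : e.event = [cellCode (a i)]) (ht : (0, .atom .eq 1) ∈ e.guard → tw i) :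
    WordInv c₀ c₁ b n a tw (i + 1) e.dst := by
  have key : ∀ {c : Cell Γ Q}, e.event = [cellCode c] → a i = c := fun hc => by
    rw [ha, List.singleton_inj, cellCode_inj] at hc
    exact hc
  cases he with
  | first =>
    obtain rfl := h.start rfl
    refine ⟨?_, fun _ => ⟨by omega, key rfl⟩, ?_, ?_, ?_, ?_⟩ <;> simp [PEdge.dst]
    omega
  | padLeft =>
    have hl := h.left rfl
    refine ⟨?_, fun _ => ⟨by omega, (h.sep (by simp [PEdge.src])).2⟩, ?_, ?_, ?_, ?_⟩ <;>
      simp [PEdge.dst]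
    intro j hj hj'
    rcases hj'.lt_or_eq with hj' | rfl
    · exact hl j hj hj'
    · exact key rfl
  | head =>
    have hl := h.left rfl
    have hs := h.sep (by simp [PEdge.src])
    refine ⟨?_, fun _ => ⟨by omega, hs.2⟩, ?_, ?_, ?_, ?_⟩ <;> simp [PEdge.dst]
    refine ⟨hs.1, fun j hj hj' => ?_⟩
    rcases hj'.lt_or_eq with hj' | rfl
    · rw [hl j hj hj', initCell_neg]
      omega
    · rw [key rfl, sub_self, initCell_zero]
  | second =>
    obtain ⟨hi, hl⟩ := h.head rfl
    have hs := h.sep (by simp [PEdge.src])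
    refine ⟨?_, fun _ => ⟨by omega, hs.2⟩, ?_, ?_, fun _ => ⟨le_rfl, i - 1, by omega,
      Or.inl (by simp only [PEdge.dst]; omega), fun j hj hj' => ?_⟩, ?_⟩
    · simp [PEdge.dst]
    · simp only [PEdge.dst]; omega
    · simp only [PEdge.dst]; omega
    · have hc : ((i - 1 : ℕ) : ℤ) = i - 1 := by omega
      rcases Nat.lt_succ_iff_lt_or_eq.1 hj' with hj' | rfl
      · rw [hl j hj hj', hc]
      · rw [key rfl, hc, sub_sub_cancel, initCell_one]
    · simp only [PEdge.dst]; omega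
  | input m hm =>
    obtain ⟨-, o, ho, hor, hl⟩ := h.tail (by simp only [PEdge.src]; omega)
    have hs := h.sep (by simp [PEdge.src])
    simp only [PEdge.src] at hor
    refine ⟨?_, fun _ => ⟨by omega, hs.2⟩, ?_, ?_, fun _ => ⟨by simp only [PEdge.dst]; omega, o,
      ho, Or.inl (by simp only [PEdge.dst]; omega), fun j hj hj' => ?_⟩, ?_⟩
    · simp [PEdge.dst]
    · simp only [PEdge.dst]; omega
    · simp only [PEdge.dst]; omega
    · rcases Nat.lt_succ_iff_lt_or_eq.1 hj' with hj' | rfl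
      · exact hl j hj hj'
      · rw [key rfl, initCell_input] <;> omega
    · simp only [PEdge.dst]; omega
  | padRight =>
    obtain ⟨-, o, ho, hor, hl⟩ := h.tail le_rfl
    have hs := h.sep (by simp [PEdge.src])
    simp only [PEdge.src] at hor
    refine ⟨?_, fun _ => ⟨by omega, hs.2⟩, ?_, ?_, fun _ => ⟨by simp [PEdge.dst], o,
      ho, Or.inr ⟨rfl, by omega⟩, fun j hj hj' => ?_⟩, ?_⟩
    · simp [PEdge.dst]
    · simp [PEdge.dst]
    · simp [PEdge.dst]
    · rcases Nat.lt_succ_iff_lt_or_eq.1 hj' with hj' | rfl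
      · exact hl j hj hj'
      · rw [key rfl, initCell_right]
        omega
    · simp [PEdge.dst]
  | sep =>
    obtain ⟨-, o, ho, hor, hl⟩ := h.tail le_rfl
    have hs := h.sep (by simp [PEdge.src])
    simp only [PEdge.src] at hor
    refine ⟨?_, fun _ => ⟨by omega, hs.2⟩, ?_, ?_, ?_, fun _ => ⟨i, o, ho, by omega, by omega,
      key rfl, ht (by simp [PEdge.guard]), hl⟩⟩ <;> simp [PEdge.dst]
  | cell c =>
    obtain ⟨w, o, h1, h2, h3, h4⟩ := h.next rfl
    have hs := h.sep (by simp [PEdge.src])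
    refine ⟨?_, fun _ => ⟨by omega, hs.2⟩, ?_, ?_, ?_, fun _ => ⟨w, o, h1, h2, by omega, h4⟩⟩ <;>
      simp [PEdge.dst]
  | halt c =>
    have hs := h.sep (by simp [PEdge.src])
    refine ⟨?_, fun _ => ⟨by omega, hs.2⟩, ?_, ?_, ?_, ?_⟩ <;> simp [PEdge.dst]

theorem WordEdge.rst_eq_nil {e : PEdge ℕ} (he : WordEdge M c₀ c₁ b n e) (h0 : e.src ≠ 0) :
    e.rst = [] := by
  cases he <;> simp_all [PEdge.rst, PEdge.src]

theorem WordEdge.haltCell {e : PEdge ℕ} (he : WordEdge M c₀ c₁ b n e) (h3 : e.dst = 3)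
    {c : Cell Γ Q} (hc : e.event = [cellCode c]) : HaltCell M c ∧ e.src = 10 := by
  cases he <;> simp_all [PEdge.dst, PEdge.src, PEdge.event, cellCode_inj]
  all_goals omega

theorem run_wordInv (h : η.IsAccRun natR (diagramPTA M c₀ c₁ b n))
    (h0 : WordEdge M c₀ c₁ b n (η.edge 0)) {a : ℕ → Cell Γ Q}
    (ha : ∀ i < η.n, (η.edge i).event = [cellCode (a i)]) {i : ℕ} (hi : i < η.n) :
    WordInv c₀ c₁ b n a (fun w => η.time w = η.time 0 + 1) i (η.edge i).src := by
  induction i with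
  | zero =>
    rw [run_src_zero h]
    constructor <;> simp
  | succ i ih =>
    have hi' : i < η.n := by omega
    rw [run_src_succ h hi]
    refine (ih hi').succ (run_wordEdge h h0 hi') (ha i hi') fun hg => ?_
    have g := run_guard h hi' hg
    have hi0 : i ≠ 0 := by
      rintro rfl
      simp [(run_guard_zero h).1] at hg
    rw [PRun.mu_add_eq (r := 0) (by omega) (by simp [(run_guard_zero h).2])] at g
    · have : η.time i - η.time 0 = 1 := by simpa [ClkC.holds, Cmp.denote, natR] using g
      linarith
    · intro j hj hj'
      have hjn : j < η.n := by omega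
      rw [(run_wordEdge h h0 hjn).rst_eq_nil fun hs => hj.ne' (run_eq_zero_of_src h hjn hs)]
      simp

/-- The ways in which a run can fail to be a space-time diagram. -/
structure Faultless (M : TM0.Machine Γ Q) (η : PRun ℕ) : Prop where
  not_early : ∀ k m, k + 1 < η.n → m < η.n → η.time k + 1 < η.time m →
    η.time (k + 1) < η.time m → η.time (k + 1) + 1 ≤ η.time m
  not_skipped : ∀ j k, j < k → k + 1 < η.n → η.time k < η.time j + 1 →
    η.time (k + 1) ≤ η.time j + 1
  copied : ∀ k m (p q r s : Cell Γ Q), k + 2 < η.n → m < η.n → η.time m = η.time (k + 1) + 1 →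
    cellCode p ∈ (η.edge k).event → cellCode q ∈ (η.edge (k + 1)).event →
    cellCode r ∈ (η.edge (k + 2)).event → cellCode s ∈ (η.edge m).event → s = nextCell M p q r

theorem Faultless.time_add (hf : Faultless M η) {B : PTA ℕ} (h : η.IsRun natR B) {w : ℕ}
    (hw : 2 ≤ w) (ht : η.time w = η.time 0 + 1) :
    ∀ k, k + w < η.n → η.time (k + w) = η.time k + 1 := by
  intro k
  induction k with
  | zero => exact fun _ => by simpa using ht
  | succ k ih =>
    intro hk
    have hk' : k + w + 1 < η.n := by omega
    have e := ih (by omega)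
    rw [show k + 1 + w = k + w + 1 by omega]
    have h1 := h.time_lt (show k + w < k + w + 1 by omega) hk'
    have h2 := h.time_lt (show k < k + 1 by omega) (by omega)
    refine le_antisymm ?_ ?_
    · exact hf.not_skipped (k + 1) (k + w) (by omega) hk' (by linarith)
    · exact hf.not_early k (k + w + 1) (by omega) hk' (by linarith)
        (h.time_lt (by omega) hk')

theorem halts_of_faultless (h : η.IsAccRun natR (diagramPTA M c₀ c₁ b n))
    (h0 : WordEdge M c₀ c₁ b n (η.edge 0)) (hf : Faultless M η) :
    (TM0.eval M (c₀ :: c₁ :: List.replicate n b)).Dom := by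
  obtain ⟨a, ha⟩ := run_exists_word h h0
  have hn := h.1.1
  have hlast : η.n - 1 < η.n := by omega
  obtain ⟨hhalt, hsrc⟩ := (run_wordEdge h h0 hlast).haltCell
    (by simpa [diagramPTA] using h.2) (ha _ hlast)
  have inv := run_wordInv h h0 ha hlast
  obtain ⟨w, o, ho, how, hw, haw, htw, hrow⟩ := inv.next hsrc
  refine IsDiagram.halts (M := M) (a := a) (N := η.n - 1) (w := w) (o := o)
    ⟨ho, how, by omega, (inv.sep (by omega)).2, haw, hrow, fun k hk hkN => ?_, hhalt⟩
  refine hf.copied (k - 1) (k + w) _ _ _ _ (by omega) (by omega) ?_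
    ?_ ?_ ?_ ?_
  · rw [Nat.sub_add_cancel hk]
    exact hf.time_add h.1 (by omega) htw k (by omega)
  · simp [ha (k - 1) (by omega)]
  · rw [Nat.sub_add_cancel hk]
    simp [ha k (by omega)]
  · rw [show k - 1 + 2 = k + 1 by omega]
    simp [ha (k + 1) (by omega)]
  · simp [ha (k + w) (by omega)]

/-- The states of the run reading a diagram with row length `w = o + (n + 2) + p`. -/
def diagramState (n N w o i : ℕ) : ℕ :=
  if i = 0 then 0 else if i ≤ o then 7 else if i = o + 1 then 8
  else if i ≤ w then 11 + (n - (i - o - 2)) else if i ≤ N then 10 else 3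

/-- The edges of the run reading a diagram. -/
noncomputable def diagramEdge (n : ℕ) (a : ℕ → Cell Γ Q) (N w o i : ℕ) : PEdge ℕ :=
  (diagramState n N w o i, [cellCode (a i)],
    if i = 0 then [(0, .atom .gt 0)] else if i = w then [(0, .atom .eq 1)] else [],
    if i = 0 then [0] else [], diagramState n N w o (i + 1))

theorem wordEdge_diagramEdge {a : ℕ → Cell Γ Q} {N w o p : ℕ} (hw : w = o + (n + 2) + p)
    (h : IsDiagram M (c₀ :: c₁ :: List.replicate n b) a N w o) {i : ℕ} (hi : i ≤ N) :
    WordEdge M c₀ c₁ b n (diagramEdge n a N w o i) := by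
  have ho := h.pos
  have hwN : w < N := lt_of_le_of_ne h.le fun e => by
    obtain ⟨s, q, hs, -⟩ := h.halt
    rw [← e, h.sep₁] at hs
    cases hs
  have row : ∀ j : ℕ, 1 ≤ j → j < w → a j = initCell Q c₀ c₁ b n (j - o) := h.row
  by_cases h0 : i = 0
  · subst h0
    have e : diagramEdge n a N w o 0 =
        (0, [cellCode (none : Cell Γ Q)], [(0, .atom .gt 0)], [0], 7) := by
      simp [diagramEdge, diagramState, h.sep₀, ho]
    rw [e]
    exact .first
  by_cases h1 : i < o
  · have e : diagramEdge n a N w o i =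
        (7, [cellCode (some (default, none) : Cell Γ Q)], [], [], 7) := by
      rw [diagramEdge, row i (by omega) (by omega), initCell_neg _ _ _ _ _ (by omega)]
      simp [diagramState, h0, h1.le, show i + 1 ≤ o by omega, show i ≠ w by omega]
    rw [e]
    exact .padLeft
  by_cases h2 : i = o
  · have e : diagramEdge n a N w o i =
        (7, [cellCode (some (c₀, some default) : Cell Γ Q)], [], [], 8) := by
      rw [diagramEdge, row i (by omega) (by omega), h2, sub_self, initCell_zero]
      simp [diagramState, show o ≠ 0 by omega, show o ≠ w by omega]
    rw [e]
    exact .head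
  by_cases h3 : i = o + 1
  · have e : diagramEdge n a N w o i =
        (8, [cellCode (some (c₁, none) : Cell Γ Q)], [], [], 11 + n) := by
      rw [diagramEdge, row i (by omega) (by omega), show (i : ℤ) - o = 1 by omega, initCell_one]
      simp [diagramState, h3, show o + 1 ≠ w by omega, show o + 1 + 1 ≤ w by omega]
      omega
    rw [e]
    exact .second
  by_cases h4 : i < o + 2 + n
  · have e : diagramEdge n a N w o i = (12 + (n - (i - o - 1)),
        [cellCode (some (b, none) : Cell Γ Q)], [], [], 11 + (n - (i - o - 1))) := by
      rw [diagramEdge, row i (by omega) (by omega), initCell_input _ _ _ _ _ (by omega) (by omega)]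
      simp [diagramState, h0, h3, show i ≠ w by omega, show i + 1 ≤ w by omega,
        show ¬ i ≤ o by omega, show ¬ i + 1 ≤ o by omega, h2, show i ≤ w by omega]
      omega
    rw [e]
    exact .input _ (by omega)
  by_cases h5 : i < w
  · have e : diagramEdge n a N w o i =
        (11, [cellCode (some (default, none) : Cell Γ Q)], [], [], 11) := by
      rw [diagramEdge, row i (by omega) (by omega), initCell_right _ _ _ _ _ (by omega)]
      simp [diagramState, h0, h3, show i ≠ w by omega, show i + 1 ≤ w by omega,
        show ¬ i ≤ o by omega, show ¬ i + 1 ≤ o by omega, h2, show i ≤ w by omega]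
      omega
    rw [e]
    exact .padRight
  by_cases h6 : i = w
  · have e : diagramEdge n a N w o i =
        (11, [cellCode (none : Cell Γ Q)], [(0, .atom .eq 1)], [], 10) := by
      rw [diagramEdge, h6, h.sep₁]
      simp [diagramState, show w ≠ 0 by omega, show ¬ w ≤ o by omega, show w ≠ o + 1 by omega,
        show w ≠ o by omega, show w + 1 ≤ N by omega, show ¬ w + 1 ≤ o by omega]
      omega
    rw [e]
    exact .sep
  have e : diagramEdge n a N w o i =
      (10, [cellCode (a i)], [], [], if i + 1 ≤ N then 10 else 3) := by
    simp [diagramEdge, diagramState, h0, h3, h6, show ¬ i ≤ w by omega, show ¬ i + 1 ≤ w by omega,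
      show ¬ i ≤ o by omega, show ¬ i + 1 ≤ o by omega, h2, hi]
  rw [e]
  split_ifs with h7
  · exact .cell _
  · obtain rfl : i = N := by omega
    exact .halt _ h.halt

theorem exists_faultless (h : (TM0.eval M (c₀ :: c₁ :: List.replicate n b)).Dom) :
    ∃ η : PRun ℕ, η.IsAccRun natR (diagramPTA M c₀ c₁ b n) ∧
      WordEdge M c₀ c₁ b n (η.edge 0) ∧ Faultless M η := by
  obtain ⟨a, N, p, hd⟩ := exists_isDiagram h
  generalize hoo : 1 + p = o at hd
  obtain ⟨w, hw⟩ : ∃ w, w = o + (n + 2) + p := ⟨_, rfl⟩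
  rw [show o + (c₀ :: c₁ :: List.replicate n b).length + p = w by simp [hw]] at hd
  have ho := hd.pos
  have hwpos : (0 : ℝ) < w := by
    have : 0 < w := by omega
    exact_mod_cast this
  set η : PRun ℕ := ⟨(List.range (N + 1)).map (diagramEdge n a N w o),
    (List.range (N + 1)).map fun k : ℕ => 1 + (k : ℝ) / w⟩ with hη
  have hn : η.n = N + 1 := by simp [hη, PRun.n]
  have hedge : ∀ i ≤ N, η.edge i = diagramEdge n a N w o i := fun i hi => by
    simp [hη, PRun.edge, List.getD, show i < N + 1 by omega]
  have htime : ∀ i ≤ N, η.time i = 1 + (i : ℝ) / w := fun i hi => by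
    simp [hη, PRun.time, List.getD, show i < N + 1 by omega]
  have hev : ∀ i ≤ N, (η.edge i).event = [cellCode (a i)] := fun i hi => by
    rw [hedge i hi]
    rfl
  have hword : ∀ i ≤ N, WordEdge M c₀ c₁ b n (η.edge i) := fun i hi => by
    rw [hedge i hi]
    exact wordEdge_diagramEdge hw hd hi
  have hadd : ∀ k : ℕ, (k : ℝ) / w + 1 = ((k + w : ℕ) : ℝ) / w := fun k => by
    push_cast
    field_simp
  have hlt : ∀ {j k : ℕ}, (j : ℝ) / w < k / w ↔ j < k := fun {j k} => by
    rw [div_lt_div_iff_of_pos_right hwpos, Nat.cast_lt]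
  have hle : ∀ {j k : ℕ}, (j : ℝ) / w ≤ k / w ↔ j ≤ k := fun {j k} => by
    rw [div_le_div_iff_of_pos_right hwpos, Nat.cast_le]
  refine ⟨η, ⟨⟨by omega, by simp [hη, PRun.n], ?_, fun i hi => ?_, ?_, fun i hi => ?_,
    fun i hi => ?_, fun i hi q hq => ?_⟩, ?_⟩, hword 0 (by omega), fun k m hk hm h1 h2 => ?_,
    fun j k hjk hk h1 => ?_, fun k m c d e f hk hm h1 h2 h3 h4 h5 => ?_⟩
  · simp [htime 0 (by omega)]
  · rw [htime i (by omega), htime (i + 1) (by omega)]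
    have := hlt.2 (Nat.lt_succ_self i)
    linarith
  · rw [hedge 0 (by omega)]
    simp [diagramEdge, diagramState, PEdge.src, diagramPTA]
  · exact mem_trans_diagramPTA.2 (Or.inr (hword i (by omega)))
  · rw [hedge i (by omega), hedge (i + 1) (by omega)]
    rfl
  · rw [hedge i (by omega)] at hq
    by_cases hi0 : i = 0
    · subst hi0
      obtain rfl : q = (0, .atom .gt 0) := by simpa [diagramEdge, PEdge.guard] using hq
      rw [PRun.mu_zero_add, htime 0 (by omega)]
      simp [ClkC.holds, Cmp.denote, natR]
    · by_cases hiw : i = w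
      · obtain rfl : q = (0, .atom .eq 1) := by
          simpa [diagramEdge, PEdge.guard, hi0, hiw, show w ≠ 0 by omega] using hq
        rw [PRun.mu_add_eq (r := 0) (by omega)]
        · rw [htime 0 (by omega), htime i (by omega), hiw, div_self hwpos.ne']
          simp [ClkC.holds, Cmp.denote, natR]
        · rw [hedge 0 (by omega)]
          simp [diagramEdge, PEdge.rst]
        · intro j hj hj'
          rw [hedge j (by omega)]
          simp [diagramEdge, PEdge.rst, hj.ne']
      · simp [diagramEdge, PEdge.guard, hi0, hiw] at hq
  · have hle := hd.le
    rw [hn, Nat.add_sub_cancel, hedge N le_rfl]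
    simp [diagramEdge, diagramState, PEdge.dst, diagramPTA, show ¬ N + 1 ≤ o by omega,
      show ¬ N + 1 ≤ w by omega, show N ≠ o by omega]
  · rw [htime k (by omega), htime m (by omega), add_assoc, hadd, add_lt_add_iff_left, hlt] at h1
    rw [htime (k + 1) (by omega), htime m (by omega), add_assoc, hadd, add_le_add_iff_left, hle]
    omega
  · rw [htime j (by omega), htime k (by omega), add_assoc, hadd, add_lt_add_iff_left, hlt] at h1
    rw [htime (k + 1) (by omega), htime j (by omega), add_assoc, hadd, add_le_add_iff_left, hle]
    omega
  · rw [htime m (by omega), htime (k + 1) (by omega), add_assoc, hadd, add_right_inj] at h1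
    have hm' : m = k + 1 + w := le_antisymm (hle.1 h1.le) (hle.1 h1.ge)
    rw [hev k (by omega), List.mem_singleton, cellCode_inj] at h2
    rw [hev (k + 1) (by omega), List.mem_singleton, cellCode_inj] at h3
    rw [hev (k + 2) (by omega), List.mem_singleton, cellCode_inj] at h4
    rw [hev m (by omega), List.mem_singleton, cellCode_inj] at h5
    rw [h2, h3, h4, h5, hm', hd.next (k + 1) (by omega) (by omega)]
    rfl

end Words

/-! ### The formula -/

namespace HF

/-- The interval `[0, ∞)`. -/
def always : FIvl ℕ := ⟨0, none, true, false⟩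

/-- Path `1` has an event. -/
def onOne : HF ℕ := .disj (.pos 0 1) (.neg 0 1)

/-- An unsatisfiable formula. -/
def falsum : HF ℕ := .conj (.pos 0 1) (.neg 0 1)

/-- `ψ` holds at a later event. -/
def later (ψ : HF ℕ) : HF ℕ := .fut always ψ

/-- `ψ` holds at the next event. -/
def nxt (ψ : HF ℕ) : HF ℕ := .untl always falsum ψ

/-- The disjunction of a list of formulas. -/
def bigOr (l : List (HF ℕ)) : HF ℕ := l.foldr .disj falsum

/-- Path `1` has an event between `s + 1` and `t + 1` for consecutive event times `s` and `t`. -/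
def earlyFault : HF ℕ :=
  later (.conj (.pos 1 2) (.conj onOne (nxt (.conj (.pos 2 2) (.conj onOne
    (later (.conj (.pos 3 2) onOne)))))))

/-- Path `1` has an event time `s` such that `s + 1` lies between consecutive event times. -/
def skipFault : HF ℕ :=
  later (.conj (.pos 4 2) (.conj onOne (later (.conj (.pos 5 2) (.conj onOne
    (nxt (.conj (.pos 6 2) onOne)))))))

/-- Path `1` has consecutive labels `p`, `q`, `r`, and the label one time unit after `q` is `s`. -/
def copyFault (p q r s : ℕ) : HF ℕ :=
  later (.conj (.pos p 1) (nxt (.conj (.pos 7 2) (.conj (.pos q 1)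
    (.conj (nxt (.pos r 1)) (later (.conj (.pos 8 2) (.pos s 1))))))))

/-- `ψ` is quantifier-free, has only non-singular intervals, and its paths are `1` and `2`. -/
def Simple (ψ : HF ℕ) : Prop := ψ.QFree ∧ ψ.NonSing ∧ ψ.free ⊆ {1, 2}

theorem not_singular_always : ¬ always.Singular := by simp [always, FIvl.Singular]

theorem simple_pos₁ (p : ℕ) : (pos p 1).Simple := by simp [Simple, QFree, NonSing, free]

theorem simple_pos₂ (p : ℕ) : (pos p 2).Simple := by simp [Simple, QFree, NonSing, free]

theorem simple_onOne : onOne.Simple := by simp [onOne, Simple, QFree, NonSing, free]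

theorem simple_falsum : falsum.Simple := by simp [falsum, Simple, QFree, NonSing, free]

theorem Simple.disj {φ ψ : HF ℕ} (h : φ.Simple) (h' : ψ.Simple) : (HF.disj φ ψ).Simple :=
  ⟨⟨h.1, h'.1⟩, ⟨h.2.1, h'.2.1⟩, Finset.union_subset h.2.2 h'.2.2⟩

theorem Simple.conj {φ ψ : HF ℕ} (h : φ.Simple) (h' : ψ.Simple) : (HF.conj φ ψ).Simple :=
  ⟨⟨h.1, h'.1⟩, ⟨h.2.1, h'.2.1⟩, Finset.union_subset h.2.2 h'.2.2⟩

theorem Simple.later {ψ : HF ℕ} (h : ψ.Simple) : ψ.later.Simple :=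
  ⟨h.1, ⟨not_singular_always, h.2.1⟩, h.2.2⟩

theorem Simple.nxt {ψ : HF ℕ} (h : ψ.Simple) : ψ.nxt.Simple :=
  ⟨⟨simple_falsum.1, h.1⟩, ⟨not_singular_always, simple_falsum.2.1, h.2.1⟩,
    Finset.union_subset simple_falsum.2.2 h.2.2⟩

theorem simple_bigOr {l : List (HF ℕ)} (h : ∀ ψ ∈ l, ψ.Simple) : (bigOr l).Simple := by
  induction l with
  | nil => exact simple_falsum
  | cons ψ l ih =>
    exact (h ψ List.mem_cons_self).disj (ih fun χ hχ => h χ (List.mem_cons_of_mem _ hχ))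

theorem simple_earlyFault : earlyFault.Simple :=
  ((simple_pos₂ 1).conj (simple_onOne.conj ((simple_pos₂ 2).conj (simple_onOne.conj
    ((simple_pos₂ 3).conj simple_onOne).later)).nxt)).later

theorem simple_skipFault : skipFault.Simple :=
  ((simple_pos₂ 4).conj (simple_onOne.conj ((simple_pos₂ 5).conj (simple_onOne.conj
    ((simple_pos₂ 6).conj simple_onOne).nxt)).later)).later

theorem simple_copyFault (p q r s : ℕ) : (copyFault p q r s).Simple :=
  ((simple_pos₁ p).conj ((simple_pos₂ 7).conj ((simple_pos₁ q).conj
    ((simple_pos₁ r).nxt.conj ((simple_pos₂ 8).conj (simple_pos₁ s)).later))).nxt).later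

end HF

section Formula

variable {Γ Q : Type} [Fintype Γ] [Fintype Q] [Inhabited Γ] [Inhabited Q]

open Classical in
/-- The copying faults for a machine. -/
noncomputable def copyFaults (M : TM0.Machine Γ Q) : List (HF ℕ) :=
  ((Finset.univ : Finset (Cell Γ Q × Cell Γ Q × Cell Γ Q × Cell Γ Q)).filter
    fun x => x.2.2.2 ≠ nextCell M x.1 x.2.1 x.2.2.1).toList.map
    fun x => .copyFault (cellCode x.1) (cellCode x.2.1) (cellCode x.2.2.1) (cellCode x.2.2.2)

/-- Path `1` is a ruler, or path `2` measures a fault of it. -/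
noncomputable def faultBody (M : TM0.Machine Γ Q) : HF ℕ :=
  .disj (.disj (.later (.pos 1 1)) (.disj (.later (.pos 4 1)) (.later (.pos 7 1))))
    (.disj .earlyFault (.disj .skipFault (.bigOr (copyFaults M))))

/-- Every run is a ruler or has a fault. -/
noncomputable def faultFormula (M : TM0.Machine Γ Q) : HF ℕ := .all 1 (.ex 2 (faultBody M))

variable {M : TM0.Machine Γ Q} {c₀ c₁ b : Γ} {n : ℕ}

theorem mem_copyFaults {ψ : HF ℕ} : ψ ∈ copyFaults M ↔ ∃ p q r s : Cell Γ Q,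
    s ≠ nextCell M p q r ∧
      .copyFault (cellCode p) (cellCode q) (cellCode r) (cellCode s) = ψ := by
  simp [copyFaults]

theorem simple_faultBody : (faultBody M).Simple := by
  refine .disj (.disj (HF.simple_pos₁ 1).later (.disj (HF.simple_pos₁ 4).later
    (HF.simple_pos₁ 7).later)) (.disj HF.simple_earlyFault (.disj HF.simple_skipFault
    (HF.simple_bigOr fun ψ hψ => ?_)))
  obtain ⟨p, q, r, s, -, rfl⟩ := mem_copyFaults.1 hψ
  exact HF.simple_copyFault _ _ _ _

theorem sentence_faultFormula : (faultFormula M).Sentence := by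
  have := simple_faultBody (M := M).2.2
  ext x
  simp only [faultFormula, HF.free, Finset.mem_erase, Finset.notMem_empty, iff_false]
  rintro ⟨h1, h2, h⟩
  have := this h
  simp_all

theorem hyperMITL_faultFormula : (faultFormula M).HyperMITL :=
  ⟨simple_faultBody.1, simple_faultBody.2.1⟩

/-! ### Satisfaction of the formula -/

section Sat

variable {B : PTA ℕ} {E : ℕ → PRun ℕ} {V : Finset ℕ} {t : ℝ} {d : Option ℕ} {ψ : HF ℕ}

theorem psat_later : PSat natR B none ψ.later V E t d ↔
    ∃ t', t < t' ∧ (∃ π ∈ V, (E π).EvtTime t') ∧ PSat natR B none ψ V E t' d := by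
  simp only [HF.later, PSat, inBd, FIvl.Mem, HF.always, natR, true_and]
  refine exists_congr fun t' => and_congr_right fun h => ?_
  simp [h.le]

theorem not_psat_falsum (h : (E 1).IsRun natR B) : ¬ PSat natR B none .falsum V E t d := by
  rintro ⟨⟨i, hi, hti, hp⟩, j, hj, htj, hp'⟩
  obtain rfl := h.time_inj hi hj (hti.trans htj.symm)
  exact hp' hp

theorem psat_nxt (h : (E 1).IsRun natR B) : PSat natR B none ψ.nxt V E t d ↔
    ∃ t', t < t' ∧ (∃ π ∈ V, (E π).EvtTime t') ∧ PSat natR B none ψ V E t' d ∧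
      ∀ t'', t < t'' → t'' < t' → ¬ ∃ π ∈ V, (E π).EvtTime t'' := by
  simp only [HF.nxt, PSat, inBd, FIvl.Mem, HF.always, natR, true_and, not_psat_falsum h]
  refine exists_congr fun t' => and_congr_right fun h => ?_
  simp [h.le]

theorem psat_bigOr (h : (E 1).IsRun natR B) {l : List (HF ℕ)} :
    PSat natR B none (.bigOr l) V E t d ↔ ∃ ψ ∈ l, PSat natR B none ψ V E t d := by
  induction l with
  | nil => simp [HF.bigOr, not_psat_falsum h]
  | cons ψ l ih =>
    rw [List.exists_mem_cons_iff, ← ih]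
    rfl

theorem psat_onOne : PSat natR B none .onOne V E t d ↔ (E 1).EvtTime t := by
  constructor
  · rintro (⟨i, hi, hti, -⟩ | ⟨i, hi, hti, -⟩) <;> exact ⟨i, hi, hti⟩
  · rintro ⟨i, hi, hti⟩
    by_cases hp : 0 ∈ ((E 1).edge i).event
    · exact Or.inl ⟨i, hi, hti, hp⟩
    · exact Or.inr ⟨i, hi, hti, hp⟩

theorem PRun.IsRun.eq_succ {η : PRun ℕ} (h : η.IsRun natR B) {k m : ℕ} (hk : k < η.n)
    (hm : m < η.n) (hkm : η.time k < η.time m)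
    (hno : ∀ t, η.time k < t → t < η.time m → ¬ η.EvtTime t) : m = k + 1 := by
  have hlt := (h.time_lt_iff hk hm).1 hkm
  by_contra hne
  exact hno (η.time (k + 1)) (h.time_lt (by omega) (by omega)) (h.time_lt (by omega) hm)
    ⟨k + 1, by omega, rfl⟩

theorem PRun.IsRun.not_evtTime {η : PRun ℕ} (h : η.IsRun natR B) {k : ℕ} (hk : k + 1 < η.n)
    (h1 : η.time k < t) (h2 : t < η.time (k + 1)) : ¬ η.EvtTime t := by
  rintro ⟨i, hi, rfl⟩
  have := (h.time_lt_iff (by omega) hi).1 h1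
  have := (h.time_lt_iff hi hk).1 h2
  omega

variable (h₁ : (E 1).IsAccRun natR (diagramPTA M c₀ c₁ b n))
  (h₂ : (E 2).IsAccRun natR (diagramPTA M c₀ c₁ b n))

include h₁ h₂

theorem not_psat_earlyFault (hf : Faultless M (E 1)) (hV : V = {2, 1}) :
    ¬ PSat natR (diagramPTA M c₀ c₁ b n) none .earlyFault V E t d := by
  subst hV
  rw [HF.earlyFault, psat_later]
  rintro ⟨t₁, -, -, ⟨i, hi, hti, hpi⟩, hk, hX⟩
  obtain ⟨k, hk, htk⟩ := psat_onOne.1 hk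
  obtain ⟨t₂, ht₂, -, ⟨⟨j, hj, htj, hpj⟩, hk', hF⟩, hno⟩ := (psat_nxt h₁.1).1 hX
  obtain ⟨k', hk', htk'⟩ := psat_onOne.1 hk'
  obtain ⟨t₃, ht₃, -, ⟨l, hl, htl, hpl⟩, hm⟩ := psat_later.1 hF
  obtain ⟨m, hm, htm⟩ := psat_onOne.1 hm
  obtain ⟨rfl, h3, e0, e1, e2, d1, d2⟩ := run_of_one_mem h₂ hi hpi
  obtain rfl : j = 1 := by
    obtain rfl | rfl | rfl : j = 0 ∨ j = 1 ∨ j = 2 := by omega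
    all_goals simp_all
  obtain rfl : l = 2 := by
    obtain rfl | rfl | rfl : l = 0 ∨ l = 1 ∨ l = 2 := by omega
    all_goals simp_all
  obtain rfl := h₁.1.eq_succ hk hk' (by linarith) fun t a b hc =>
    hno t (by linarith) (by linarith) ⟨1, by simp, hc⟩
  have := hf.not_early k m hk' hm (by linarith) (by linarith)
  linarith

theorem not_psat_skipFault (hf : Faultless M (E 1)) (hV : V = {2, 1}) :
    ¬ PSat natR (diagramPTA M c₀ c₁ b n) none .skipFault V E t d := by
  subst hV
  rw [HF.skipFault, psat_later]
  rintro ⟨t₁, -, -, ⟨i, hi, hti, hpi⟩, hk, hX⟩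
  obtain ⟨k, hk, htk⟩ := psat_onOne.1 hk
  obtain ⟨t₂, ht₂, -, ⟨j, hj, htj, hpj⟩, hk', hF⟩ := psat_later.1 hX
  obtain ⟨k', hk', htk'⟩ := psat_onOne.1 hk'
  obtain ⟨t₃, ht₃, -, ⟨⟨l, hl, htl, hpl⟩, hm⟩, hno⟩ := (psat_nxt h₁.1).1 hF
  obtain ⟨m, hm, htm⟩ := psat_onOne.1 hm
  obtain ⟨rfl, h3, e0, e1, e2, d1, d2⟩ := run_of_four_mem h₂ hi hpi
  obtain rfl : j = 1 := by
    obtain rfl | rfl | rfl : j = 0 ∨ j = 1 ∨ j = 2 := by omega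
    all_goals simp_all
  obtain rfl : l = 2 := by
    obtain rfl | rfl | rfl : l = 0 ∨ l = 1 ∨ l = 2 := by omega
    all_goals simp_all
  obtain rfl := h₁.1.eq_succ hk' hm (by linarith) fun t a b hc =>
    hno t (by linarith) (by linarith) ⟨1, by simp, hc⟩
  have := hf.not_skipped k k' ((h₁.1.time_lt_iff hk hk').1 (by linarith)) hm (by linarith)
  linarith

theorem not_psat_copyFault (hf : Faultless M (E 1)) (hV : V = {2, 1}) {p q r s : Cell Γ Q}
    (hs : s ≠ nextCell M p q r) :
    ¬ PSat natR (diagramPTA M c₀ c₁ b n) none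
      (.copyFault (cellCode p) (cellCode q) (cellCode r) (cellCode s)) V E t d := by
  subst hV
  rw [HF.copyFault, psat_later]
  rintro ⟨t₁, -, -, ⟨k, hk, htk, hpk⟩, hX⟩
  obtain ⟨t₂, ht₂, -, ⟨⟨i, hi, hti, hpi⟩, ⟨k', hk', htk', hpk'⟩, hX', hF⟩, hno⟩ :=
    (psat_nxt h₁.1).1 hX
  obtain ⟨t₃, ht₃, -, ⟨k'', hk'', htk'', hpk''⟩, hno'⟩ := (psat_nxt h₁.1).1 hX'
  obtain ⟨t₄, ht₄, -, ⟨j, hj, htj, hpj⟩, m, hm, htm, hpm⟩ := psat_later.1 hF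
  obtain ⟨rfl, h3, e0, e1, d1⟩ := run_of_seven_mem h₂ hi hpi
  obtain rfl : j = 1 := by
    obtain rfl | rfl : j = 0 ∨ j = 1 := by omega
    all_goals simp_all
  obtain rfl := h₁.1.eq_succ hk hk' (by linarith) fun t a b hc =>
    hno t (by linarith) (by linarith) ⟨1, by simp, hc⟩
  obtain rfl := h₁.1.eq_succ hk' hk'' (by linarith) fun t a b hc =>
    hno' t (by linarith) (by linarith) ⟨1, by simp, hc⟩
  exact hs (hf.copied k m p q r s hk'' hm (by linarith) hpk hpk' hpk'' hpm)

theorem faultBody_not_psat (h0 : WordEdge M c₀ c₁ b n ((E 1).edge 0)) (hf : Faultless M (E 1))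
    (hV : V = {2, 1}) :
    ¬ PSat natR (diagramPTA M c₀ c₁ b n) none (faultBody M) V E t d := by
  have hr : ∀ p < 10, ¬ PSat natR (diagramPTA M c₀ c₁ b n) none (.later (.pos p 1)) V E t d := by
    intro p hp hc
    obtain ⟨t', -, -, i, hi, -, hpi⟩ := psat_later.1 hc
    obtain ⟨a, ha⟩ := (run_wordEdge h₁ h0 hi).exists_event
    have := ten_le_cellCode a
    rw [ha, List.mem_singleton] at hpi
    omega
  rintro ((h | h | h) | h | h | h)
  · exact hr 1 (by omega) h
  · exact hr 4 (by omega) h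
  · exact hr 7 (by omega) h
  · exact not_psat_earlyFault h₁ h₂ hf hV h
  · exact not_psat_skipFault h₁ h₂ hf hV h
  · obtain ⟨ψ, hψ, h⟩ := (psat_bigOr h₁.1).1 h
    obtain ⟨p, q, r, s, hs, rfl⟩ := mem_copyFaults.1 hψ
    exact not_psat_copyFault h₁ h₂ hf hV hs h

end Sat

theorem exists_psat_of_not_faultless {η : PRun ℕ}
    (h : η.IsAccRun natR (diagramPTA M c₀ c₁ b n)) (hf : ¬ Faultless M η) (E : ℕ → PRun ℕ)
    (d : Option ℕ) : ∃ ζ : PRun ℕ, ζ.IsAccRun natR (diagramPTA M c₀ c₁ b n) ∧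
      PSat natR (diagramPTA M c₀ c₁ b n) none (faultBody M) {2, 1}
        (Function.update (Function.update E 1 η) 2 ζ) 0 d := by
  have hE1 : ∀ ζ, Function.update (Function.update E 1 η) 2 ζ 1 = η := fun ζ => by
    simp [Function.update]
  have hev : ∀ ζ t, (∃ π ∈ ({2, 1} : Finset ℕ),
      (Function.update (Function.update E 1 η) 2 ζ π).EvtTime t) ↔
      ζ.EvtTime t ∨ η.EvtTime t := fun ζ t => by simp
  by_cases c1 : ∀ k m, k + 1 < η.n → m < η.n → η.time k + 1 < η.time m →
    η.time (k + 1) < η.time m → η.time (k + 1) + 1 ≤ η.time m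
  swap
  · push Not at c1
    obtain ⟨k, m, hk, hm, h1, h2, h3⟩ := c1
    have hkk := h.1.time_lt (Nat.lt_succ_self k) hk
    obtain ⟨ζ, hζ, hn, e0, e1, e2, t0, t1, t2⟩ := exists_run_one (M := M) (c₀ := c₀) (c₁ := c₁)
      (b := b) (n := n) (run_time_pos h (show k < η.n by omega)) hkk h2 (by linarith)
      (by linarith)
    refine ⟨ζ, hζ, Or.inr (Or.inl (psat_later.2 ⟨η.time k, run_time_pos h (by omega),
      (hev _ _).2 (Or.inr ⟨k, by omega, rfl⟩), ⟨0, ?_⟩, psat_onOne.2 ?_,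
      (psat_nxt (by rw [hE1]; exact h.1)).2 ⟨η.time (k + 1), hkk,
        (hev _ _).2 (Or.inr ⟨k + 1, hk, rfl⟩), ⟨⟨1, ?_⟩, psat_onOne.2 ?_,
        psat_later.2 ⟨η.time m, h2, (hev _ _).2 (Or.inr ⟨m, hm, rfl⟩), ⟨2, ?_⟩,
          psat_onOne.2 ?_⟩⟩, fun t ht ht' hc => ?_⟩⟩))⟩
    · simp [hn, t0, e0]
    · rw [hE1]; exact ⟨k, by omega, rfl⟩
    · simp [hn, t1, e1]
    · rw [hE1]; exact ⟨k + 1, by omega, rfl⟩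
    · simp [hn, t2, e2]
    · rw [hE1]; exact ⟨m, by omega, rfl⟩
    · rcases (hev _ _).1 hc with ⟨i, hi, rfl⟩ | hc
      · obtain rfl | rfl | rfl : i = 0 ∨ i = 1 ∨ i = 2 := by omega
        all_goals linarith
      · exact h.1.not_evtTime hk ht ht' hc
  by_cases c2 : ∀ j k, j < k → k + 1 < η.n → η.time k < η.time j + 1 →
    η.time (k + 1) ≤ η.time j + 1
  swap
  · push Not at c2
    obtain ⟨j, k, hjk, hk, h1, h2⟩ := c2
    have hkk := h.1.time_lt (Nat.lt_succ_self k) hk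
    have hjt := h.1.time_lt hjk (show k < η.n by omega)
    obtain ⟨ζ, hζ, hn, e0, e1, e2, t0, t1, t2⟩ := exists_run_four (M := M) (c₀ := c₀) (c₁ := c₁)
      (b := b) (n := n) (run_time_pos h (show j < η.n by omega)) hjt hkk (by linarith)
      (by linarith)
    refine ⟨ζ, hζ, Or.inr (Or.inr (Or.inl (psat_later.2 ⟨η.time j, run_time_pos h (by omega),
      (hev _ _).2 (Or.inr ⟨j, by omega, rfl⟩), ⟨0, ?_⟩, psat_onOne.2 ?_,
      psat_later.2 ⟨η.time k, hjt, (hev _ _).2 (Or.inr ⟨k, by omega, rfl⟩), ⟨1, ?_⟩,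
        psat_onOne.2 ?_, (psat_nxt (by rw [hE1]; exact h.1)).2 ⟨η.time (k + 1), hkk,
          (hev _ _).2 (Or.inr ⟨k + 1, hk, rfl⟩), ⟨⟨2, ?_⟩, psat_onOne.2 ?_⟩,
          fun t ht ht' hc => ?_⟩⟩⟩)))⟩
    · simp [hn, t0, e0]
    · rw [hE1]; exact ⟨j, by omega, rfl⟩
    · simp [hn, t1, e1]
    · rw [hE1]; exact ⟨k, by omega, rfl⟩
    · simp [hn, t2, e2]
    · rw [hE1]; exact ⟨k + 1, by omega, rfl⟩
    · rcases (hev _ _).1 hc with ⟨i, hi, rfl⟩ | hc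
      · obtain rfl | rfl | rfl : i = 0 ∨ i = 1 ∨ i = 2 := by omega
        all_goals linarith
      · exact h.1.not_evtTime hk ht ht' hc
  obtain ⟨k, m, p, q, r, s, hk, hm, h1, hp, hq, hr, hs, hne⟩ : ∃ k m, ∃ p q r s : Cell Γ Q,
      k + 2 < η.n ∧ m < η.n ∧ η.time m = η.time (k + 1) + 1 ∧
      cellCode p ∈ (η.edge k).event ∧ cellCode q ∈ (η.edge (k + 1)).event ∧
      cellCode r ∈ (η.edge (k + 2)).event ∧ cellCode s ∈ (η.edge m).event ∧
      s ≠ nextCell M p q r := by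
    by_contra hc
    refine hf ⟨c1, c2, fun k m p q r s hk hm h1 hp hq hr hs => ?_⟩
    by_contra hne
    exact hc ⟨k, m, p, q, r, s, hk, hm, h1, hp, hq, hr, hs, hne⟩
  have hk1 := h.1.time_lt (Nat.lt_succ_self k) (show k + 1 < η.n by omega)
  have hk2 := h.1.time_lt (Nat.lt_succ_self (k + 1)) hk
  have hmk : η.time (k + 2) ≤ η.time m := by
    refine h.1.time_le ?_ hm
    exact (h.1.time_lt_iff (show k + 1 < η.n by omega) hm).1 (by linarith)
  obtain ⟨ζ, hζ, hn, e0, e1, t0, t1⟩ := exists_run_seven (M := M) (c₀ := c₀) (c₁ := c₁)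
    (b := b) (n := n) (run_time_pos h (show k + 1 < η.n by omega))
  refine ⟨ζ, hζ, Or.inr (Or.inr (Or.inr ((psat_bigOr (by rw [hE1]; exact h.1)).2
    ⟨_, mem_copyFaults.2 ⟨p, q, r, s, hne, rfl⟩, psat_later.2 ⟨η.time k,
      run_time_pos h (by omega), (hev _ _).2 (Or.inr ⟨k, by omega, rfl⟩), ⟨k, ?_⟩,
      (psat_nxt (by rw [hE1]; exact h.1)).2 ⟨η.time (k + 1), hk1,
        (hev _ _).2 (Or.inr ⟨k + 1, by omega, rfl⟩), ⟨⟨0, ?_⟩, ⟨k + 1, ?_⟩,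
        (psat_nxt (by rw [hE1]; exact h.1)).2 ⟨η.time (k + 2), hk2,
          (hev _ _).2 (Or.inr ⟨k + 2, by omega, rfl⟩), ⟨k + 2, ?_⟩, fun t ht ht' hc => ?_⟩,
        psat_later.2 ⟨η.time m, by linarith, (hev _ _).2 (Or.inr ⟨m, by omega, rfl⟩), ⟨1, ?_⟩,
          m, ?_⟩⟩, fun t ht ht' hc => ?_⟩⟩⟩)))⟩
  · rw [hE1]; exact ⟨by omega, rfl, hp⟩
  · simp [hn, t0, e0]
  · rw [hE1]; exact ⟨by omega, rfl, hq⟩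
  · rw [hE1]; exact ⟨by omega, rfl, hr⟩
  · rcases (hev _ _).1 hc with ⟨i, hi, rfl⟩ | hc
    · obtain rfl | rfl : i = 0 ∨ i = 1 := by omega
      all_goals linarith
    · exact h.1.not_evtTime hk ht ht' hc
  · simp [hn, t1, e1, h1]
  · rw [hE1]; exact ⟨by omega, rfl, hs⟩
  · rcases (hev _ _).1 hc with ⟨i, hi, rfl⟩ | hc
    · obtain rfl | rfl : i = 0 ∨ i = 1 := by omega
      all_goals linarith
    · exact h.1.not_evtTime (by omega) ht ht' hc

theorem exists_psat_of_ruler {η : PRun ℕ} (h : η.IsAccRun natR (diagramPTA M c₀ c₁ b n))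
    (he : η.edge 0 ∈ rulerEdges) (E : ℕ → PRun ℕ) (d : Option ℕ) :
    ∃ ζ : PRun ℕ, ζ.IsAccRun natR (diagramPTA M c₀ c₁ b n) ∧
      PSat natR (diagramPTA M c₀ c₁ b n) none (faultBody M) {2, 1}
        (Function.update (Function.update E 1 η) 2 ζ) 0 d := by
  refine ⟨η, h, Or.inl ?_⟩
  have hE1 : Function.update (Function.update E 1 η) 2 η 1 = η := by
    simp [Function.update]
  have key : ∀ p, p ∈ (η.edge 0).event → PSat natR (diagramPTA M c₀ c₁ b n) none
      (.later (.pos p 1)) {2, 1} (Function.update (Function.update E 1 η) 2 η) 0 d :=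
    fun p hp => psat_later.2 ⟨η.time 0, run_time_pos h h.1.1,
      ⟨2, by simp, by simpa using ⟨0, h.1.1, rfl⟩⟩, ⟨0, by rw [hE1]; exact ⟨h.1.1, rfl, hp⟩⟩⟩
  have hs := run_src_zero h
  have : 1 ∈ (η.edge 0).event ∨ 4 ∈ (η.edge 0).event ∨ 7 ∈ (η.edge 0).event := by
    generalize η.edge 0 = e at he hs
    rcases mem_rulerEdges.1 he with rfl | rfl | rfl | rfl | rfl | rfl | rfl | rfl <;>
      simp_all [PEdge.src, PEdge.event]
  exact this.imp (key 1) (Or.imp (key 4) (key 7))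

theorem psat_faultFormula : PSat natR (diagramPTA M c₀ c₁ b n) none (faultFormula M) ∅
    (fun _ => default) 0 none ↔ ¬ (TM0.eval M (c₀ :: c₁ :: List.replicate n b)).Dom := by
  have hV : insert 2 (insert 1 (∅ : Finset ℕ)) = {2, 1} := rfl
  simp only [faultFormula, PSat, hV]
  constructor
  · intro hall hhalt
    obtain ⟨η, hη, h0, hf⟩ := exists_faultless hhalt
    obtain ⟨ζ, ⟨hζ, -⟩, -, hsat⟩ := hall η ⟨hη, by simp⟩ (by simp)
    have hE1 : (Function.update (Function.update (fun _ => default) 1 η) 2 ζ : ℕ → PRun ℕ) 1 = η := by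
      simp [Function.update]
    refine faultBody_not_psat ?_ ?_ ?_ ?_ rfl hsat
    · rwa [hE1]
    · simpa using hζ
    · rwa [hE1]
    · rwa [hE1]
  · rintro hhalt η ⟨hη, -⟩ -
    have hex : ∃ ζ : PRun ℕ, ζ.IsAccRun natR (diagramPTA M c₀ c₁ b n) ∧
        PSat natR (diagramPTA M c₀ c₁ b n) none (faultBody M) {2, 1}
          (Function.update (Function.update (fun _ => default) 1 η) 2 ζ) 0 (some 2) := by
      rcases mem_trans_diagramPTA.1 (run_edge_mem hη hη.1.1) with he | he
      · exact exists_psat_of_ruler hη he _ _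
      · exact exists_psat_of_not_faultless hη
          (fun hf => hhalt (halts_of_faultless hη he hf)) _ _
    obtain ⟨ζ, hζ, hsat⟩ := hex
    refine ⟨ζ, ⟨hζ, by simp⟩, Or.inr ⟨1, rfl, ?_, 0, by omega, by omega, rfl, rfl, by omega,
      fun j _ hj => ?_, fun j _ hj => run_time_pos hζ hj⟩, hsat⟩
    · simp only [Function.update_self]
      have := hη.1.1
      exact (run_time_pos hη (by omega)).le
    · rw [Function.update_self] at hj ⊢
      exact run_time_pos hη hj

end Formula

/-! ### Computability of the reduction -/

section Encoding

variable {Γ Q : Type} [Fintype Γ] [Fintype Q] [Inhabited Γ] [Inhabited Q]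

theorem primrec_encList_chainEdges (M : TM0.Machine Γ Q) (c₀ b : Γ) :
    Primrec fun n => encList encPEdge (chainEdges M c₀ b n) := by
  have hstep : Primrec₂ fun j r : ℕ => Nat.pair (encPEdge
      (12 + j, [cellCode (some (b, none) : Cell Γ Q)], [], [], 11 + j)) r + 1 := by
    refine Primrec.succ.comp (Primrec₂.natPair.comp ?_ Primrec.snd)
    have h12 : Primrec fun x : ℕ × ℕ => 12 + x.1 :=
      Primrec.nat_add.comp (Primrec.const 12) Primrec.fst
    have h11 : Primrec fun x : ℕ × ℕ => 11 + x.1 :=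
      Primrec.nat_add.comp (Primrec.const 11) Primrec.fst
    exact Primrec₂.natPair.comp h12 (Primrec₂.natPair.comp (Primrec.const _)
      (Primrec₂.natPair.comp (Primrec.const _) (Primrec₂.natPair.comp (Primrec.const _) h11)))
  refine (Primrec.nat_rec₁ (encList encPEdge (chainEdges M c₀ b 0)) hstep).of_eq fun n => ?_
  induction n with
  | zero => rfl
  | succ n ih =>
    simp only [ih]
    rfl

theorem primrec_encPTA_diagramPTA (M : TM0.Machine Γ Q) (c₀ c₁ b : Γ) :
    Primrec fun n => encPTA (diagramPTA M c₀ c₁ b n) := by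
  have h11 : Primrec fun n : ℕ => 11 + n := Primrec.nat_add.comp (Primrec.const 11) Primrec.id
  have hedge : Primrec fun n : ℕ =>
      encPEdge (8, [cellCode (some (c₁, none) : Cell Γ Q)], [], [], 11 + n) :=
    Primrec₂.natPair.comp (Primrec.const _) (Primrec₂.natPair.comp (Primrec.const _)
      (Primrec₂.natPair.comp (Primrec.const _) (Primrec₂.natPair.comp (Primrec.const _) h11)))
  have htrans : Primrec fun n => encList encPEdge (diagramPTA M c₀ c₁ b n).trans :=
    Primrec.succ.comp (Primrec₂.natPair.comp hedge (primrec_encList_chainEdges M c₀ b))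
  exact Primrec₂.natPair.comp (Primrec.const _) (Primrec₂.natPair.comp (Primrec.const _)
    (Primrec₂.natPair.comp (Primrec.const _) (Primrec₂.natPair.comp (Primrec.const _)
      (Primrec₂.natPair.comp htrans (Primrec.const _)))))

end Encoding

theorem not_exists_dec_hyperMITL : ¬ ∃ dec : ℕ → Bool, Computable dec ∧
    ∀ (B : PTA ℕ) (φ : HF ℕ), φ.Sentence → φ.HyperMITL →
      (dec (Nat.pair (encPTA B) (encHF φ)) = true ↔
        PSat natR B none φ ∅ (fun _ => default) 0 none) := by
  rintro ⟨dec, hdec, hcorrect⟩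
  obtain ⟨Γ, Q, _, _, _, _, M, c₀, c₁, b, hM⟩ := exists_undecidable_machine
  have henc : Computable fun n =>
      Nat.pair (encPTA (diagramPTA M c₀ c₁ b n)) (encHF (faultFormula M)) :=
    (Primrec₂.natPair.comp (primrec_encPTA_diagramPTA M c₀ c₁ b) (Primrec.const _)).to_comp
  have hnot : ComputablePred fun n =>
      ¬ (TM0.eval M (c₀ :: c₁ :: List.replicate n b)).Dom := by
    refine ComputablePred.computable_iff.2 ⟨_, hdec.comp henc, funext fun n => propext ?_⟩
    rw [hcorrect _ _ sentence_faultFormula hyperMITL_faultFormula]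
    exact psat_faultFormula.symm
  exact hM (hnot.not.of_eq fun n => not_not)

end Reduction

/-- The general (unbounded) verification problem for HCMTL* in the
point-based semantics is undecidable: no computable function decides, on the code of a
pair `(B, φ)` of a point-based timed automaton and an HCMTL* sentence, whether
`{}, 0, ε ⊨_B φ` under the point-based semantics. Undecidability already holds when `φ`
is restricted to the HyperMITL fragment. -/
theorem general_point_verification_undecidable :
    (¬ ∃ dec : ℕ → Bool, Computable dec ∧
      ∀ (B : PTA ℕ) (φ : HF ℕ), φ.Sentence →
        (dec (Nat.pair (encPTA B) (encHF φ)) = true ↔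
          PSat natR B none φ ∅ (fun _ => default) 0 none)) ∧
    (¬ ∃ dec : ℕ → Bool, Computable dec ∧
      ∀ (B : PTA ℕ) (φ : HF ℕ), φ.Sentence → φ.HyperMITL →
        (dec (Nat.pair (encPTA B) (encHF φ)) = true ↔
          PSat natR B none φ ∅ (fun _ => default) 0 none)) :=
  ⟨fun ⟨dec, hdec, h⟩ => not_exists_dec_hyperMITL ⟨dec, hdec, fun B φ hφ _ => h B φ hφ⟩,
    not_exists_dec_hyperMITL⟩

end HyTime
end

section
/- Let A be a timed automaton and φ an HCMTL* formula in which clock-constraint constants and interval endpoints are allowed to be nonnegative rationals, and let λ be the least common multiple of the denominators of all rational constants occurring in A and φ. Let A′ and φ′ be obtained from A and φ by multiplying every constant by λ (so that all constants in A′ and φ′ are natural numbers). Then for every time bound N > 0 the bounded-time model checking problems agree: {}, 0, ε ⊨^N_A φ if and only if {}, 0, ε ⊨^{λN}_{A′} φ′ (interval-based semantics). -/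
namespace HyTime

section Constants

theorem dvd_foldr_lcm {l : List ℕ} {n : ℕ} (h : n ∈ l) : n ∣ l.foldr Nat.lcm 1 := by
  induction l with
  | nil => simp at h
  | cons a l ih =>
    rcases List.mem_cons.1 h with rfl | h
    · exact Nat.dvd_lcm_left _ _
    · exact (ih h).trans (Nat.dvd_lcm_right _ _)

theorem foldr_lcm_pos {l : List ℕ} (h : ∀ n ∈ l, 0 < n) : 0 < l.foldr Nat.lcm 1 := by
  induction l with
  | nil => simp
  | cons a l ih =>
    exact Nat.lcm_pos (h a (by simp)) (ih fun n hn => h n (by simp [hn]))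

theorem den_natCast_mul_of_dvd {q : ℚ} {n : ℕ} (h : q.den ∣ n) : ((n : ℚ) * q).den = 1 := by
  obtain ⟨k, rfl⟩ := h
  have : ((q.den * k : ℕ) : ℚ) * q = ((k * q.num : ℤ) : ℚ) := by
    push_cast
    rw [mul_right_comm, mul_comm (q.den : ℚ) q, Rat.mul_den_eq_num, mul_comm]
  rw [this]
  exact Rat.den_intCast _

variable {α β : Type} (f : α → β)

theorem ClkC.consts_map (κ : ClkC α) : (κ.map f).consts = κ.consts.map f := by
  induction κ with
  | atom c k => rfl
  | disj a b iha ihb => simp [ClkC.map, ClkC.consts, iha, ihb]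
  | conj a b iha ihb => simp [ClkC.map, ClkC.consts, iha, ihb]

theorem TA.consts_map (A : TA α) : (A.map f).consts = A.consts.map f := by
  simp [TA.consts, TA.map, List.flatMap_map, List.map_flatMap, Function.comp_def,
    ClkC.consts_map]

theorem FIvl.consts_map (I : FIvl α) : (I.map f).consts = I.consts.map f := by
  cases h : I.hi <;> simp [FIvl.consts, FIvl.map, h]

theorem HF.consts_map (φ : HF α) : (φ.map f).consts = φ.consts.map f := by
  induction φ <;> simp_all [HF.map, HF.consts, FIvl.consts_map]

theorem ClkC.map_injective {f : α → β} (hf : Function.Injective f) :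
    Function.Injective (ClkC.map f) := by
  intro κ
  induction κ with
  | atom c k =>
    rintro (_ | _ | _) h <;> simp_all [ClkC.map]
    exact hf h.2
  | disj a b iha ihb =>
    rintro (_ | ⟨a', b'⟩ | ⟨a', b'⟩) h <;> simp only [ClkC.map, reduceCtorEq] at h
    injection h with h₁ h₂
    rw [iha h₁, ihb h₂]
  | conj a b iha ihb =>
    rintro (_ | ⟨a', b'⟩ | ⟨a', b'⟩) h <;> simp only [ClkC.map, reduceCtorEq] at h
    injection h with h₁ h₂
    rw [iha h₁, ihb h₂]

theorem ClkC.map_map {γ : Type} (g : β → γ) (κ : ClkC α) :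
    (κ.map f).map g = κ.map (g ∘ f) := by
  induction κ <;> simp_all [ClkC.map]

theorem ClkC.map_id (κ : ClkC α) : κ.map id = κ := by
  induction κ <;> simp_all [ClkC.map]

theorem TA.betaOf_map (A : TA α) (v x : ℕ) :
    (A.map f).betaOf v x = (A.betaOf v x).map (ClkC.map f) := by
  simp [TA.betaOf, TA.map, List.find?_map, Function.comp_def]

end Constants

section Scaling

variable {c : ℚ}

/-- Apply a function to the constants of a guard. -/
def mapGuard {α β : Type} (f : α → β) (g : List (ℕ × ClkC α)) : List (ℕ × ClkC β) :=
  g.map (fun q => (q.1, q.2.map f))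

theorem mapGuard_injective {α β : Type} {f : α → β} (hf : Function.Injective f) :
    Function.Injective (mapGuard f) := by
  refine List.map_injective_iff.2 ?_
  rintro ⟨x, κ⟩ ⟨y, κ'⟩ h
  simp only [Prod.mk.injEq] at h
  rw [h.1, ClkC.map_injective hf h.2]

/-- Scale the endpoints of a real interval. -/
def TIvl.scale (r : ℝ) (I : TIvl) : TIvl := ⟨r * I.lo, r * I.hi, I.loC, I.hiC⟩

/-- Scale all time points and all guard constants of an execution. -/
def RawExec.scale (c : ℚ) (ρ : RawExec ℚ) : RawExec ℚ :=
  ⟨ρ.states, ρ.ivls.map (TIvl.scale c), ρ.guards.map (mapGuard (c * ·)), ρ.resets⟩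

theorem ClkC.holds_scale (hc : 0 < c) (v : ℝ) (κ : ClkC ℚ) :
    (κ.map (c * ·)).holds ratR (c * v) ↔ κ.holds ratR v := by
  have hc' : (0 : ℝ) < c := by exact_mod_cast hc
  induction κ with
  | atom o k =>
    cases o <;> simp [ClkC.map, ClkC.holds, Cmp.denote, ratR, hc', hc'.ne']
  | disj a b iha ihb => simp [ClkC.map, ClkC.holds, iha, ihb]
  | conj a b iha ihb => simp [ClkC.map, ClkC.holds, iha, ihb]

theorem ClkC.holdsOpt_scale (hc : 0 < c) (v : ℝ) (κ : Option (ClkC ℚ)) :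
    holdsOpt ratR (c * v) (κ.map (ClkC.map (c * ·))) ↔ holdsOpt ratR v κ := by
  cases κ with
  | none => rfl
  | some κ => exact ClkC.holds_scale hc v κ

theorem FIvl.mem_scale (hc : 0 < c) (t t' : ℝ) (I : FIvl ℚ) :
    FIvl.Mem ratR (c * t) (c * t') (I.map (c * ·)) ↔ FIvl.Mem ratR t t' I := by
  have hc' : (0 : ℝ) < c := by exact_mod_cast hc
  rcases I with ⟨lo, _ | hi, _ | _, _ | _⟩ <;>
    simp [FIvl.Mem, FIvl.map, ratR, ← mul_add, hc']

namespace TIvl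

variable {r : ℝ}

theorem mem_scale (hr : 0 < r) (t : ℝ) (I : TIvl) :
    TIvl.Mem (r * t) (I.scale r) ↔ TIvl.Mem t I := by
  rcases I with ⟨lo, hi, _ | _, _ | _⟩ <;> simp [TIvl.Mem, TIvl.scale, hr]

theorem wf_scale (hr : 0 < r) (I : TIvl) : (I.scale r).WF ↔ I.WF := by
  simp [TIvl.WF, TIvl.scale, hr, hr.ne']

theorem consecutive_scale (hr : 0 < r) (I J : TIvl) :
    (I.scale r).Consecutive (J.scale r) ↔ I.Consecutive J := by
  simp [TIvl.Consecutive, TIvl.scale, hr.ne']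

theorem scale_injective (hr : 0 < r) : Function.Injective (TIvl.scale r) := by
  rintro ⟨⟩ ⟨⟩ h
  simpa [TIvl.scale, hr.ne'] using h

theorem scale_default : (default : TIvl).scale r = default := by
  have : (default : TIvl) = ⟨0, 0, false, false⟩ := rfl
  simp [this, TIvl.scale]

end TIvl

namespace RawExec

theorem ivl_scale (ρ : RawExec ℚ) (i : ℕ) : (ρ.scale c).ivl i = (ρ.ivl i).scale c := by
  conv_lhs => rw [ivl, ← TIvl.scale_default (r := c)]
  exact List.getD_map _ _ _

theorem guard_scale (ρ : RawExec ℚ) (i : ℕ) :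
    (ρ.scale c).guard i = mapGuard (c * ·) (ρ.guard i) := by
  exact List.getD_map _ [] (mapGuard (c * ·))

theorem mu_scale (ρ : RawExec ℚ) (i x : ℕ) : (ρ.scale c).mu i x = c * ρ.mu i x := by
  induction i with
  | zero => simp [mu]
  | succ i ih =>
    have hreset : (ρ.scale c).reset i = ρ.reset i := rfl
    by_cases h : x ∈ ρ.reset i
    · simp [mu, hreset, h]
    · simp only [mu, hreset, h, if_false, ih, ivl_scale, TIvl.scale]
      ring

theorem memLen_scale (hc : 0 < c) (t : ℝ) (ρ : RawExec ℚ) :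
    MemLen (c * t) (ρ.scale c) ↔ MemLen t ρ := by
  have hc' : (0 : ℝ) < c := by exact_mod_cast hc
  simp only [MemLen, ivl_scale, TIvl.mem_scale hc']
  rfl

theorem stateAt_scale (hc : 0 < c) (t : ℝ) (v : ℕ) (ρ : RawExec ℚ) :
    StateAt (ρ.scale c) (c * t) v ↔ StateAt ρ t v := by
  have hc' : (0 : ℝ) < c := by exact_mod_cast hc
  simp only [StateAt, ivl_scale, TIvl.mem_scale hc']
  rfl

theorem scale_injective (hc : 0 < c) : Function.Injective (scale c) := by
  have hc' : (0 : ℝ) < c := by exact_mod_cast hc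
  rintro ⟨s, i, g, rs⟩ ⟨s', i', g', rs'⟩ h
  simp only [scale, RawExec.mk.injEq] at h ⊢
  exact ⟨h.1, List.map_injective_iff.2 (TIvl.scale_injective hc') h.2.1,
    List.map_injective_iff.2 (mapGuard_injective (mul_right_injective₀ hc.ne')) h.2.2.1,
    h.2.2.2⟩

theorem scale_surjective (hc : 0 < c) : Function.Surjective (scale c) := by
  have hc' : (0 : ℝ) < c := by exact_mod_cast hc
  intro ρ
  refine ⟨ρ.scale c⁻¹, ?_⟩
  have hI : TIvl.scale c ∘ TIvl.scale ((c⁻¹ : ℚ) : ℝ) = id := by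
    funext I
    simp [TIvl.scale, hc'.ne']
  have hG : mapGuard (c * ·) ∘ mapGuard (fun q : ℚ => c⁻¹ * q) = id := by
    funext g
    simp [mapGuard, Function.comp_def, ClkC.map_map, hc.ne']
    exact (List.map_congr_left fun q _ => by
      rw [show (fun x : ℚ => x) = id from rfl, ClkC.map_id]; rfl).trans (List.map_id g)
  simp only [scale, List.map_map, hI, hG, List.map_id]

theorem idxAt_scale (hc : 0 < c) (t : ℝ) (ρ : RawExec ℚ) :
    (ρ.scale c).idxAt (c * t) = ρ.idxAt t := by
  have hc' : (0 : ℝ) < c := by exact_mod_cast hc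
  rw [idxAt, idxAt, scale, List.findIdx_map]
  congr 1
  funext I
  exact decide_eq_decide.2 (TIvl.mem_scale hc' t I)

theorem prefixUpTo_scale (hc : 0 < c) (t : ℝ) (ρ : RawExec ℚ) :
    (ρ.scale c).prefixUpTo (c * t) = (ρ.prefixUpTo t).scale c := by
  simp only [prefixUpTo, idxAt_scale hc, ivl_scale]
  simp [scale, TIvl.scale]

theorem eqUpTo_scale (hc : 0 < c) (t : ℝ) (ρ₁ ρ₂ : RawExec ℚ) :
    EqUpTo (ρ₁.scale c) (ρ₂.scale c) (c * t) ↔ EqUpTo ρ₁ ρ₂ t := by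
  rw [EqUpTo, EqUpTo, prefixUpTo_scale hc, prefixUpTo_scale hc, (scale_injective hc).eq_iff]

theorem edge_scale_mem (hc : 0 < c) (A : TA ℚ) (ρ : RawExec ℚ) (i : ℕ) :
    (ρ.scale c).edge i ∈ (A.map (c * ·)).edges ↔ ρ.edge i ∈ A.edges := by
  set g : IEdge ℚ → IEdge ℚ := fun e => (e.1, e.2.1, mapGuard (c * ·) e.2.2.1, e.2.2.2)
  have hg : Function.Injective g := by
    rintro ⟨a, b, k, d⟩ ⟨a', b', k', d'⟩ h
    simp only [g, Prod.mk.injEq] at h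
    obtain ⟨rfl, rfl, h, rfl⟩ := h
    rw [mapGuard_injective (mul_right_injective₀ hc.ne') h]
  have he : (ρ.scale c).edge i = g (ρ.edge i) := by
    simp only [edge, guard_scale, g]
    rfl
  rw [he]
  exact List.mem_map_of_injective hg

theorem isExec_scale (hc : 0 < c) (A : TA ℚ) (ρ : RawExec ℚ) :
    (ρ.scale c).IsExec ratR (A.map (c * ·)) ↔ ρ.IsExec ratR A := by
  have hc' : (0 : ℝ) < c := by exact_mod_cast hc
  have hn : (ρ.scale c).n = ρ.n := rfl
  have hs : ∀ i, (ρ.scale c).state i = ρ.state i := fun _ => rfl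
  have hi : (ρ.scale c).ivls.length = ρ.ivls.length := by simp [scale]
  have hgl : (ρ.scale c).guards.length = ρ.guards.length := by simp [scale]
  have hr : (ρ.scale c).resets = ρ.resets := rfl
  have hlo : ((ρ.ivl 0).scale c).lo = 0 ↔ (ρ.ivl 0).lo = 0 := by
    simp [TIvl.scale, hc'.ne']
  have hloC : ((ρ.ivl 0).scale c).loC = (ρ.ivl 0).loC := rfl
  have hinit : (A.map (c * ·)).init = A.init := rfl
  have hclk : (A.map (c * ·)).clocks = A.clocks := rfl
  have hb : ∀ i x, (∀ t : ℝ, TIvl.Mem t ((ρ.ivl i).scale c) →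
      ClkC.holdsOpt ratR (c * ρ.mu i x + t - ((ρ.ivl i).scale c).lo)
        ((A.map (c * ·)).betaOf (ρ.state i) x)) ↔
      ∀ t : ℝ, TIvl.Mem t (ρ.ivl i) →
        ClkC.holdsOpt ratR (ρ.mu i x + t - (ρ.ivl i).lo) (A.betaOf (ρ.state i) x) := by
    intro i x
    rw [(mul_left_surjective₀ hc'.ne').forall]
    refine forall_congr' fun t => ?_
    rw [TIvl.mem_scale hc', TA.betaOf_map, ← ClkC.holdsOpt_scale hc (ρ.mu i x + t - _)]
    simp only [TIvl.scale, mul_add, mul_sub]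
  have hgd : ∀ i, (∀ q ∈ mapGuard (c * ·) (ρ.guard i),
      ClkC.holds ratR (c * ρ.mu i q.1 + ((ρ.ivl i).scale c).hi - ((ρ.ivl i).scale c).lo) q.2) ↔
      ∀ q ∈ ρ.guard i, ClkC.holds ratR (ρ.mu i q.1 + (ρ.ivl i).hi - (ρ.ivl i).lo) q.2 := by
    intro i
    rw [mapGuard, List.forall_mem_map]
    refine forall₂_congr fun q _ => ?_
    rw [← ClkC.holds_scale hc (ρ.mu i q.1 + _ - _)]
    simp only [TIvl.scale, mul_add, mul_sub]
  simp only [IsExec, hn, hs, hi, hgl, hr, ivl_scale, hlo, hloC, TIvl.wf_scale hc',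
    TIvl.consecutive_scale hc', hinit, hclk, edge_scale_mem hc, mu_scale, guard_scale, hb, hgd]

theorem inSem_scale (hc : 0 < c) (A : TA ℚ) (N : ℝ) (ρ : RawExec ℚ) :
    InSem ratR (A.map (c * ·)) (some (c * N)) (ρ.scale c) ↔ InSem ratR A (some N) ρ := by
  have hc' : (0 : ℝ) < c := by exact_mod_cast hc
  have hb : BoundedBy (ρ.scale c) (c * N) ↔ BoundedBy ρ N := by
    rw [BoundedBy, (mul_left_surjective₀ hc'.ne').forall]
    simp only [memLen_scale hc, mul_le_mul_iff_right₀ hc']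
    rfl
  simp only [InSem, IsAccExec, isExec_scale hc, Option.some.injEq, forall_eq', hb]
  rfl

end RawExec

theorem HSat_scale (hc : 0 < c) (A : TA ℚ) (N : ℝ) (φ : HF ℚ) (Env : ℕ → RawExec ℚ) (t : ℝ)
    (d : Option ℕ) :
    HSat ratR (A.map (c * ·)) (some (c * N)) (φ.map (c * ·))
      (fun π => (Env π).scale c) (c * t) d ↔ HSat ratR A (some N) φ Env t d := by
  have hc' : (0 : ℝ) < c := by exact_mod_cast hc
  have hsurj : Function.Surjective (fun t : ℝ => c * t) := mul_left_surjective₀ hc'.ne'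
  have hupd : ∀ (Env : ℕ → RawExec ℚ) π ρ,
      Function.update (fun π => (Env π).scale c) π (ρ.scale c) =
        fun π' => (Function.update Env π ρ π').scale c :=
    fun Env π ρ => (Function.comp_update (RawExec.scale c) Env π ρ).symm
  have hlab : ∀ v, (A.map (c * ·)).labelOf v = A.labelOf v := fun _ => rfl
  induction φ generalizing Env t d with
  | pos p π => simp only [HF.map, HSat, RawExec.memLen_scale hc, RawExec.stateAt_scale hc, hlab]
  | neg p π => simp only [HF.map, HSat, RawExec.memLen_scale hc, RawExec.stateAt_scale hc, hlab]
  | disj a b iha ihb => simp only [HF.map, HSat, iha, ihb]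
  | conj a b iha ihb => simp only [HF.map, HSat, iha, ihb]
  | fut I a ih =>
    simp only [HF.map, HSat, inBd]
    rw [hsurj.exists]
    simp only [mul_lt_mul_iff_right₀ hc', FIvl.mem_scale hc, ih]
  | glob I a ih =>
    simp only [HF.map, HSat, inBd]
    rw [hsurj.forall]
    simp only [mul_lt_mul_iff_right₀ hc', FIvl.mem_scale hc, ih]
  | untl I a b iha ihb =>
    have hall : ∀ t', (∀ t'', c * t < t'' → t'' < c * t' →
        HSat ratR (A.map (c * ·)) (some (c * N)) (a.map (c * ·))
          (fun π => (Env π).scale c) t'' d) ↔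
        ∀ t'', t < t'' → t'' < t' → HSat ratR A (some N) a Env t'' d := by
      intro t'
      rw [hsurj.forall]
      simp only [mul_lt_mul_iff_right₀ hc', iha]
    simp only [HF.map, HSat, inBd]
    rw [hsurj.exists]
    simp only [mul_lt_mul_iff_right₀ hc', FIvl.mem_scale hc, ihb, hall]
  | ex π a ih =>
    simp only [HF.map, HSat]
    rw [(RawExec.scale_surjective hc).exists]
    simp only [RawExec.inSem_scale hc, RawExec.memLen_scale hc, RawExec.eqUpTo_scale hc, hupd, ih,
      mul_eq_zero, hc'.ne', false_or]
  | all π a ih =>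
    simp only [HF.map, HSat]
    rw [(RawExec.scale_surjective hc).forall]
    simp only [RawExec.inSem_scale hc, RawExec.memLen_scale hc, RawExec.eqUpTo_scale hc, hupd, ih,
      mul_eq_zero, hc'.ne', false_or]

end Scaling

/-- Let `A` be a timed automaton and `φ` an HCMTL* sentence whose
clock-constraint constants and interval endpoints are nonnegative rationals, let `λ` be
the least common multiple of the denominators of all rational constants occurring in `A`
and `φ`, and let `A'`, `φ'` be obtained by multiplying every constant by `λ`. Then all
constants of `A'` and `φ'` are natural numbers, and for every time bound `N > 0` the
bounded-time model checking problems agree: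
`{}, 0, ε ⊨^N_A φ` iff `{}, 0, ε ⊨^{λN}_{A'} φ'` (interval-based semantics). -/
theorem rational_constants_scaling (A : TA ℚ) (φ : HF ℚ) (hφ : φ.Sentence)
    (hpos : ∀ q ∈ A.consts ++ φ.consts, 0 ≤ q)
    (lam : ℕ) (hlam : lam = ((A.consts ++ φ.consts).map Rat.den).foldr Nat.lcm 1)
    (A' : TA ℚ) (hA' : A' = A.map (fun q => (lam : ℚ) * q))
    (φ' : HF ℚ) (hφ' : φ' = φ.map (fun q => (lam : ℚ) * q)) :
    (∀ q ∈ A'.consts ++ φ'.consts, q.den = 1 ∧ 0 ≤ q) ∧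
    (∀ N : ℝ, 0 < N →
      (HSat ratR A (some N) φ (fun _ => default) 0 none ↔
        HSat ratR A' (some ((lam : ℝ) * N)) φ' (fun _ => default) 0 none)) := by
  have hdvd : ∀ q ∈ A.consts ++ φ.consts, q.den ∣ lam := fun q hq => by
    rw [hlam]
    exact dvd_foldr_lcm (List.mem_map_of_mem hq)
  have hlam0 : 0 < lam := by
    rw [hlam]
    refine foldr_lcm_pos fun n hn => ?_
    obtain ⟨q, -, rfl⟩ := List.mem_map.1 hn
    exact q.den_pos
  have hlamQ : (0 : ℚ) < lam := by exact_mod_cast hlam0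
  subst hA' hφ'
  refine ⟨?_, fun N _ => ?_⟩
  · rw [TA.consts_map, HF.consts_map, ← List.map_append]
    intro q hq
    obtain ⟨r, hr, rfl⟩ := List.mem_map.1 hq
    exact ⟨den_natCast_mul_of_dvd (hdvd r hr), mul_nonneg hlamQ.le (hpos r hr)⟩
  · have h := HSat_scale hlamQ A N φ (fun _ => default) 0 none
    rw [mul_zero, Rat.cast_natCast] at h
    exact h.symm

end HyTime
end
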